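/- arXiv:1804.07512 — 8 statements merged into one kernel-verified Lean document; each statement's English description precedes it below -/
import Mathlib

section
/- Let r ≥ 1 be an integer, α, β > −1 real, and n ≥ 0 an integer. Then for every integer j with 1 ≤ j ≤ n one has ∫_0^1 x^{rj−1} p_n(x; α, β) x^β (1−x^r)^α dx = 0. -/
/-- The polynomial p_n(x; α, β) on the r-star:
p_n(x; α, β) = ∑_{k=0}^{n} C(n,k) · Γ(n+α+(β+k)/r+1) / (Γ(n+α+1) Γ((β+k)/r+1)) · (−1)^{n−k} x^k. -/
noncomputable def jacAng (r n : ℕ) (α β x : ℝ) : ℝ :=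
  ∑ k ∈ Finset.range (n + 1), (n.choose k : ℝ) *
    (Real.Gamma (n + α + (β + k) / r + 1) /
      (Real.Gamma (n + α + 1) * Real.Gamma ((β + k) / r + 1))) *
    (-1) ^ (n - k) * x ^ k

theorem Real.Gamma_add_nat_eq_ascPochhammer_mul {z : ℝ} (hz : 0 < z) (m : ℕ) :
    Real.Gamma (z + m) = (ascPochhammer ℝ m).eval z * Real.Gamma z := by
  induction m with
  | zero => simp
  | succ m ih =>
    rw [ascPochhammer_succ_eval, Nat.cast_succ, ← add_assoc,
      Real.Gamma_add_one (by positivity), ih]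
    ring

open MeasureTheory Set in
theorem integrableOn_rpow_mul_one_sub_rpow {a b : ℝ} (ha : 0 < a) (hb : 0 < b) :
    IntegrableOn (fun y : ℝ ↦ y ^ (a - 1) * (1 - y) ^ (b - 1)) (Ioc 0 1) := by
  have h := Complex.betaIntegral_convergent (u := a) (v := b) (by simpa) (by simpa)
  rw [intervalIntegrable_iff_integrableOn_Ioc_of_le zero_le_one] at h
  refine IntegrableOn.congr_fun h.re (fun x hx ↦ ?_) measurableSet_Ioc
  norm_cast
  rw [← Complex.ofReal_cpow hx.1.le, ← Complex.ofReal_cpow (by linarith [hx.2]),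
    RCLike.re_to_complex, Complex.re_mul_ofReal, Complex.ofReal_re]

open MeasureTheory Set in
theorem setIntegral_rpow_mul_one_sub_rpow {a b : ℝ} (ha : 0 < a) (hb : 0 < b) :
    ∫ y in Ioc (0 : ℝ) 1, y ^ (a - 1) * (1 - y) ^ (b - 1) = ProbabilityTheory.beta a b := by
  have h := Complex.betaIntegral_convergent (u := a) (v := b) (by simpa) (by simpa)
  rw [intervalIntegrable_iff_integrableOn_Ioc_of_le zero_le_one] at h
  rw [ProbabilityTheory.beta_eq_betaIntegralReal a b ha hb, Complex.betaIntegral,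
    intervalIntegral.integral_of_le zero_le_one, ← RCLike.re_to_complex, ← integral_re h]
  refine setIntegral_congr_fun measurableSet_Ioc fun x hx ↦ ?_
  norm_cast
  rw [← Complex.ofReal_cpow hx.1.le, ← Complex.ofReal_cpow (by linarith [hx.2]),
    RCLike.re_to_complex, Complex.re_mul_ofReal, Complex.ofReal_re]

open Set in
theorem rpow_smul_indicator_comp_rpow {p : ℝ} (hp : 0 < p) (a b : ℝ) {x : ℝ} (hx : 0 < x) :
    x ^ (p - 1) • (Ioc (0 : ℝ) 1).indicator (fun y ↦ y ^ (a - 1) * (1 - y) ^ (b - 1)) (x ^ p) =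
      (Ioc (0 : ℝ) 1).indicator (fun x ↦ x ^ (p * a - 1) * (1 - x ^ p) ^ (b - 1)) x := by
  by_cases h1 : x ≤ 1
  · have hxp : x ^ p ∈ Ioc (0 : ℝ) 1 :=
      ⟨Real.rpow_pos_of_pos hx p, Real.rpow_le_one hx.le h1 hp.le⟩
    rw [indicator_of_mem hxp, indicator_of_mem (show x ∈ Ioc (0 : ℝ) 1 from ⟨hx, h1⟩),
      smul_eq_mul, ← mul_assoc, ← Real.rpow_mul hx.le, ← Real.rpow_add hx]
    ring_nf
  · have hxp : x ^ p ∉ Ioc (0 : ℝ) 1 := fun h ↦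
      (Real.one_lt_rpow (not_le.1 h1) hp).not_ge h.2
    rw [indicator_of_notMem hxp, indicator_of_notMem (fun h ↦ h1 h.2), smul_zero]

open MeasureTheory Set in
theorem integrableOn_rpow_mul_one_sub_rpow_rpow {p a b : ℝ} (hp : 0 < p) (ha : 0 < a)
    (hb : 0 < b) :
    IntegrableOn (fun x : ℝ ↦ x ^ (p * a - 1) * (1 - x ^ p) ^ (b - 1)) (Ioc 0 1) := by
  have h := (integrable_indicator_iff measurableSet_Ioc).2
    (integrableOn_rpow_mul_one_sub_rpow ha hb)
  have h2 := (integrableOn_Ioi_comp_rpow_iff' _ hp.ne').2 h.integrableOn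
  have h3 := h2.congr_fun (fun x hx ↦ rpow_smul_indicator_comp_rpow hp a b hx) measurableSet_Ioi
  refine (h3.mono_set Ioc_subset_Ioi_self).congr_fun (fun x hx ↦ ?_) measurableSet_Ioc
  exact indicator_of_mem hx _

open MeasureTheory Set in
theorem setIntegral_rpow_mul_one_sub_rpow_rpow {p a b : ℝ} (hp : 0 < p) (ha : 0 < a)
    (hb : 0 < b) :
    ∫ x in Ioc (0 : ℝ) 1, x ^ (p * a - 1) * (1 - x ^ p) ^ (b - 1) =
      ProbabilityTheory.beta a b / p := by
  have h := integral_comp_rpow_Ioi_of_pos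
    (g := (Ioc (0 : ℝ) 1).indicator (fun y ↦ y ^ (a - 1) * (1 - y) ^ (b - 1))) hp
  have h' : Ioi (0 : ℝ) ∩ Ioc 0 1 = Ioc 0 1 := inter_eq_right.2 Ioc_subset_Ioi_self
  rw [setIntegral_indicator measurableSet_Ioc, h', setIntegral_rpow_mul_one_sub_rpow ha hb] at h
  rw [eq_div_iff hp.ne', ← h, mul_comm, ← integral_const_mul, ← h',
    ← setIntegral_indicator measurableSet_Ioc]
  refine setIntegral_congr_fun measurableSet_Ioi fun x hx ↦ ?_
  rw [indicator_const_mul, ← rpow_smul_indicator_comp_rpow hp a b hx]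
  simp only [smul_eq_mul, mul_assoc, h']

open Polynomial in
theorem Polynomial.sum_choose_mul_neg_one_pow_mul_eval_eq_zero {P : ℝ[X]} {n : ℕ}
    (hP : P.natDegree < n) :
    ∑ k ∈ Finset.range (n + 1), (n.choose k : ℝ) * (-1) ^ (n - k) * P.eval (k : ℝ) = 0 := by
  have h := congrFun (Polynomial.fwdDiff_iter_eq_zero_of_degree_lt hP) 0
  rw [fwdDiff_iter_eq_sum_shift] at h
  refine Eq.trans ?_ h
  refine Finset.sum_congr rfl fun k _ ↦ ?_
  simp only [zsmul_eq_mul, nsmul_eq_mul, mul_one, zero_add]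
  push_cast
  ring

open Polynomial in
theorem exists_polynomial_Gamma_mul_beta (r : ℕ) (hr : 1 ≤ r) (α β : ℝ) (hα : -1 < α)
    (hβ : -1 < β) (n j : ℕ) (hj1 : 1 ≤ j) (hj2 : j ≤ n) :
    ∃ P : ℝ[X], P.natDegree < n ∧ ∀ k : ℕ,
      Real.Gamma (n + α + (β + k) / r + 1) / Real.Gamma ((β + k) / r + 1) *
        ProbabilityTheory.beta (j + (β + k) / r) (α + 1) = P.eval (k : ℝ) := by
  obtain ⟨i, rfl⟩ := Nat.exists_eq_add_of_le' hj1
  obtain ⟨m, rfl⟩ := Nat.exists_eq_add_of_le hj2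
  have hr0 : (0 : ℝ) < r := by exact_mod_cast hr
  have hr1 : (1 : ℝ) ≤ r := by exact_mod_cast hr
  let L (c : ℝ) : ℝ[X] := C (1 / (r : ℝ)) * X + C c
  have hL (c : ℝ) : (L c).natDegree ≤ 1 := natDegree_linear_le
  refine ⟨C (Real.Gamma (α + 1)) * ((ascPochhammer ℝ i).comp (L (β / r + 1)) *
    (ascPochhammer ℝ m).comp (L (β / r + i + α + 2))), ?_, fun k ↦ ?_⟩
  · have hdeg (d : ℕ) (c : ℝ) : ((ascPochhammer ℝ d).comp (L c)).natDegree ≤ d := by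
      refine natDegree_comp_le.trans ?_
      rw [ascPochhammer_natDegree]
      simpa using Nat.mul_le_mul_left d (hL c)
    refine ((natDegree_C_mul_le _ _).trans natDegree_mul_le).trans_lt ?_
    have := hdeg i (β / r + 1)
    have := hdeg m (β / r + i + α + 2)
    omega
  · have hs : 0 < (β + k) / r + 1 := by
      have hk : (0 : ℝ) ≤ k := k.cast_nonneg
      rw [div_add_one hr0.ne']
      exact div_pos (by linarith) hr0
    have hs' : 0 < (β + k) / r + 1 + (i + α + 1) := by
      have : (0 : ℝ) ≤ i := i.cast_nonneg
      linarith
    have e1 := Real.Gamma_add_nat_eq_ascPochhammer_mul hs i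
    have e2 := Real.Gamma_add_nat_eq_ascPochhammer_mul hs' m
    have p1 := (Real.Gamma_pos_of_pos hs).ne'
    have p2 := (Real.Gamma_pos_of_pos hs').ne'
    have a1 : ((i + 1 + m : ℕ) : ℝ) + α + (β + k) / r + 1 =
      (β + k) / r + 1 + (i + α + 1) + m := by push_cast; ring
    have a2 : ((i + 1 : ℕ) : ℝ) + (β + k) / r = (β + k) / r + 1 + i := by push_cast; ring
    have a3 : (β + k) / r + 1 + i + (α + 1) = (β + k) / r + 1 + (i + α + 1) := by ring
    have l1 : (L (β / r + 1)).eval (k : ℝ) = (β + k) / r + 1 := by simp [L]; ring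
    have l2 : (L (β / r + i + α + 2)).eval (k : ℝ) = (β + k) / r + 1 + (i + α + 1) := by
      simp [L]; ring
    rw [ProbabilityTheory.beta, a1, a2, a3, e1, e2]
    simp only [eval_mul, eval_C, eval_comp, l1, l2]
    generalize (β + k) / r + 1 + (i + α + 1) = u at *
    generalize (β + k) / r + 1 = v at *
    field_simp

open MeasureTheory Set in
/-- For r ≥ 1, α, β > −1, n ≥ 0 and 1 ≤ j ≤ n,
∫_0^1 x^{rj−1} p_n(x; α, β) x^β (1−x^r)^α dx = 0. -/
theorem jacAng_orthogonality
    (r : ℕ) (hr : 1 ≤ r) (α β : ℝ) (hα : -1 < α) (hβ : -1 < β)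
    (n j : ℕ) (hj1 : 1 ≤ j) (hj2 : j ≤ n) :
    ∫ x in (0:ℝ)..1, x ^ (r * j - 1) * jacAng r n α β x * x ^ β * (1 - x ^ r) ^ α = 0 := by
  have hr0 : (0 : ℝ) < r := by exact_mod_cast hr
  have hb : 0 < α + 1 := by linarith
  have hrj : 1 ≤ r * j := Nat.mul_pos hr hj1
  have ha (k : ℕ) : 0 < j + (β + k) / r := by
    have hk : (0 : ℝ) ≤ k := k.cast_nonneg
    have : (1 : ℝ) ≤ r * j := by exact_mod_cast hrj
    rw [add_div' _ _ _ hr0.ne']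
    exact div_pos (by linarith) hr0
  let c (k : ℕ) : ℝ := (n.choose k : ℝ) *
    (Real.Gamma (n + α + (β + k) / r + 1) /
      (Real.Gamma (n + α + 1) * Real.Gamma ((β + k) / r + 1))) * (-1) ^ (n - k)
  obtain ⟨P, hP, hPk⟩ := exists_polynomial_Gamma_mul_beta r hr α β hα hβ n j hj1 hj2
  calc ∫ x in (0:ℝ)..1, x ^ (r * j - 1) * jacAng r n α β x * x ^ β * (1 - x ^ r) ^ α
      = ∫ x in Ioc (0 : ℝ) 1, ∑ k ∈ Finset.range (n + 1), c k *
          (x ^ ((r : ℝ) * (j + (β + k) / r) - 1) * (1 - x ^ (r : ℝ)) ^ (α + 1 - 1)) := by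
        rw [intervalIntegral.integral_of_le zero_le_one]
        refine setIntegral_congr_fun measurableSet_Ioc fun x hx ↦ ?_
        simp only [jacAng, Finset.mul_sum, Finset.sum_mul]
        refine Finset.sum_congr rfl fun k _ ↦ ?_
        have e : (r : ℝ) * (j + (β + k) / r) - 1 = ((r * j - 1 : ℕ) : ℝ) + k + β := by
          rw [Nat.cast_sub hrj]
          push_cast
          field_simp
          ring
        rw [e, Real.rpow_add hx.1, Real.rpow_add hx.1, Real.rpow_natCast, Real.rpow_natCast,
          Real.rpow_natCast, add_sub_cancel_right]
        simp only [c]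
        ring
    _ = ∑ k ∈ Finset.range (n + 1), c k *
          (ProbabilityTheory.beta (j + (β + k) / r) (α + 1) / r) := by
        rw [integral_finsetSum _ fun k _ ↦
          (integrableOn_rpow_mul_one_sub_rpow_rpow hr0 (ha k) hb).const_mul (c k)]
        refine Finset.sum_congr rfl fun k _ ↦ ?_
        rw [integral_const_mul, setIntegral_rpow_mul_one_sub_rpow_rpow hr0 (ha k) hb]
    _ = (Real.Gamma (n + α + 1) * r)⁻¹ * ∑ k ∈ Finset.range (n + 1),
          (n.choose k : ℝ) * (-1) ^ (n - k) * P.eval (k : ℝ) := by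
        rw [Finset.mul_sum]
        refine Finset.sum_congr rfl fun k _ ↦ ?_
        rw [← hPk k]
        simp only [c, div_eq_mul_inv, mul_inv]
        ring
    _ = 0 := by rw [Polynomial.sum_choose_mul_neg_one_pow_mul_eval_eq_zero hP, mul_zero]
end

section
/- Let r ≥ 1 be an integer, α, β > −1 real, and n ≥ 0 an integer. Then ∫_0^1 x^{r(n+1)−1} p_n(x; α, β) x^β (1−x^r)^α dx = n! / (rn+rα+β+r)_{n+1}, where (a)_{n+1} = Γ(a+n+1)/Γ(a) is the Pochhammer symbol. -/
/-- The Pochhammer symbol (a)_m = Γ(a+m)/Γ(a). -/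
noncomputable def poch (a : ℝ) (m : ℕ) : ℝ := Real.Gamma (a + m) / Real.Gamma a

theorem fwdDiff_iter_inv (n : ℕ) {a : ℝ} (ha : 0 < a) :
    (fwdDiff (1 : ℝ))^[n] (fun x : ℝ ↦ x⁻¹) a =
      (-1) ^ n * (n.factorial * Real.Gamma a / Real.Gamma (a + (n + 1 : ℕ))) := by
  induction n generalizing a with
  | zero =>
    have := (Real.Gamma_pos_of_pos ha).ne'
    simp [Real.Gamma_add_one ha.ne']
    field_simp
  | succ n ih =>
    have hn : 0 < a + n + 1 := by positivity
    have h1 := (Real.Gamma_pos_of_pos ha).ne'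
    have h2 := (Real.Gamma_pos_of_pos hn).ne'
    have h3 : Real.Gamma (a + 1 + (n + 1)) = (a + n + 1) * Real.Gamma (a + n + 1) := by
      rw [← Real.Gamma_add_one hn.ne']; ring_nf
    have h4 : a + (n + 1 + 1) = a + 1 + (n + 1) := by ring
    rw [Function.iterate_succ_apply', fwdDiff, ih ha, ih (by positivity : 0 < a + 1)]
    push_cast [Nat.factorial_succ]
    rw [h4, h3, Real.Gamma_add_one ha.ne', ← add_assoc]
    field_simp
    ring

open Polynomial in
theorem sum_choose_mul_eval_div_add {n : ℕ} (hn : n ≠ 0) (Q : Polynomial ℝ) (hQ : Q.natDegree ≤ n)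
    {a : ℝ} (ha : 0 < a) :
    ∑ k ∈ Finset.range (n + 1), (-1) ^ (n - k) * (n.choose k : ℝ) * (Q.eval (k : ℝ) * (k + a)⁻¹) =
      Q.eval (-a) * ((-1) ^ n *
        (n.factorial * Real.Gamma a / Real.Gamma (a + (n + 1 : ℕ)))) := by
  set R := Q /ₘ (X - C (-a))
  have hR : R.natDegree < n := by
    rw [natDegree_divByMonic _ (monic_X_sub_C _), natDegree_X_sub_C]
    omega
  have hQR : Q = C (Q.eval (-a)) + (X - C (-a)) * R := by
    rw [← modByMonic_X_sub_C_eq_C_eval, modByMonic_add_div]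
  have hRsum := congrFun (fwdDiff_iter_eq_zero_of_degree_lt hR) 0
  have hinv := fwdDiff_iter_inv n ha
  rw [fwdDiff_iter_eq_sum_shift] at hRsum hinv
  rw [← hinv, Finset.mul_sum]
  rw [← sub_eq_zero, ← Finset.sum_sub_distrib]
  refine (Finset.sum_congr rfl fun k _ ↦ ?_).trans hRsum
  have hk' : a + (k : ℝ) ≠ 0 := by positivity
  have hev : Q.eval (k : ℝ) = Q.eval (-a) + (k + a) * R.eval (k : ℝ) := by
    conv_lhs => rw [hQR]
    simp
  rw [hev]
  simp only [nsmul_eq_mul, mul_one, zero_add, zsmul_eq_mul]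
  push_cast
  rw [add_comm a]
  field_simp
  ring

theorem Real.Gamma_add_nat_eq_prod_mul {x : ℝ} (hx : 0 < x) (n : ℕ) :
    Real.Gamma (x + n) = (∏ j ∈ Finset.range n, (x + j)) * Real.Gamma x := by
  induction n with
  | zero => simp
  | succ n ih =>
    have : x + n ≠ 0 := by positivity
    rw [Finset.prod_range_succ, Nat.cast_succ, ← add_assoc, Real.Gamma_add_one this, ih]
    ring

theorem Real.Gamma_div_Gamma_add_one {x : ℝ} (hx : -1 < x) :
    Real.Gamma x / Real.Gamma (x + 1) = x⁻¹ := by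
  rcases eq_or_ne x 0 with rfl | h
  · simp
  · have h1 : Real.Gamma (x + 1) ≠ 0 := (Real.Gamma_pos_of_pos (by linarith)).ne'
    rw [Real.Gamma_add_one h] at h1 ⊢
    have := right_ne_zero_of_mul h1
    field_simp

open MeasureTheory Set in
theorem integrableOn_beta {u v : ℝ} (hu : 0 < u) (hv : 0 < v) :
    IntegrableOn (fun x : ℝ ↦ x ^ (u - 1) * (1 - x) ^ (v - 1)) (Ioo 0 1) := by
  have h := Complex.betaIntegral_convergent (u := u) (v := v) (by simpa) (by simpa)
  rw [intervalIntegrable_iff_integrableOn_Ioo_of_le zero_le_one] at h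
  refine (Integrable.re h).congr ?_
  filter_upwards [ae_restrict_mem measurableSet_Ioo] with x hx
  have h1 : ((x : ℂ)) ^ ((u : ℂ) - 1) = ((x ^ (u - 1) : ℝ) : ℂ) := by
    rw [Complex.ofReal_cpow hx.1.le]; simp
  have h2 : (1 - (x : ℂ)) ^ ((v : ℂ) - 1) = (((1 - x) ^ (v - 1) : ℝ) : ℂ) := by
    rw [Complex.ofReal_cpow (by linarith [hx.2])]; simp
  rw [h1, h2, ← Complex.ofReal_mul]
  rfl

open MeasureTheory Set in
theorem integral_beta {u v : ℝ} (hu : 0 < u) (hv : 0 < v) :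
    ∫ x in Ioo (0 : ℝ) 1, x ^ (u - 1) * (1 - x) ^ (v - 1) = ProbabilityTheory.beta u v := by
  rw [ProbabilityTheory.beta_eq_betaIntegralReal u v hu hv, Complex.betaIntegral,
    intervalIntegral.integral_of_le zero_le_one, ← integral_Ioc_eq_integral_Ioo]
  have : ∀ x ∈ Ioc (0 : ℝ) 1, (x : ℂ) ^ ((u : ℂ) - 1) * (1 - (x : ℂ)) ^ ((v : ℂ) - 1) =
      ((x ^ (u - 1) * (1 - x) ^ (v - 1) : ℝ) : ℂ) := fun x hx ↦ by
    rw [Complex.ofReal_mul, Complex.ofReal_cpow hx.1.le, Complex.ofReal_cpow (by linarith [hx.2])]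
    simp
  rw [setIntegral_congr_fun measurableSet_Ioc this, integral_complex_ofReal, Complex.ofReal_re]

open MeasureTheory Set in
theorem indicator_beta_comp_rpow {p : ℝ} (hp : 0 < p) (u v : ℝ) {x : ℝ} (hx : x ∈ Ioi (0 : ℝ)) :
    (p * x ^ (p - 1)) •
        (Ioo 0 1).indicator (fun y : ℝ ↦ y ^ (u - 1) * (1 - y) ^ (v - 1)) (x ^ p) =
      (Ioo 0 1).indicator (fun y : ℝ ↦ p * (y ^ (p * u - 1) * (1 - y ^ p) ^ (v - 1))) x := by
  have hx : 0 < x := hx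
  have hmem : x ^ p ∈ Ioo (0 : ℝ) 1 ↔ x ∈ Ioo (0 : ℝ) 1 := by
    simp [hx, Real.rpow_pos_of_pos hx, Real.rpow_lt_one_iff_of_pos hx, hp, hp.not_gt]
  by_cases h : x ∈ Ioo (0 : ℝ) 1
  · rw [indicator_of_mem h, indicator_of_mem (hmem.2 h), smul_eq_mul, ← Real.rpow_mul hx.le]
    have : x ^ (p * u - 1) = x ^ (p - 1) * x ^ (p * (u - 1)) := by
      rw [← Real.rpow_add hx]; ring_nf
    rw [this]
    ring
  · rw [indicator_of_notMem h, indicator_of_notMem (mt hmem.1 h), smul_zero]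

open MeasureTheory Set in
theorem integrableOn_beta_rpow {p u v : ℝ} (hp : 0 < p) (hu : 0 < u) (hv : 0 < v) :
    IntegrableOn (fun x : ℝ ↦ x ^ (p * u - 1) * (1 - x ^ p) ^ (v - 1)) (Ioo 0 1) := by
  have h := ((integrable_indicator_iff measurableSet_Ioo).2 (integrableOn_beta hu hv)).integrableOn
    (s := Ioi 0)
  rw [← integrableOn_Ioi_comp_rpow_iff _ hp.ne', abs_of_pos hp,
    integrableOn_congr_fun (fun x hx ↦ indicator_beta_comp_rpow hp u v hx) measurableSet_Ioi,
    IntegrableOn, integrable_indicator_iff measurableSet_Ioo, IntegrableOn,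
    Measure.restrict_restrict measurableSet_Ioo,
    inter_eq_self_of_subset_left Ioo_subset_Ioi_self] at h
  exact (integrable_const_mul_iff (isUnit_iff_ne_zero.2 hp.ne') _).1 h

open MeasureTheory Set in
theorem integral_beta_rpow {p u v : ℝ} (hp : 0 < p) (hu : 0 < u) (hv : 0 < v) :
    ∫ x in Ioo (0 : ℝ) 1, x ^ (p * u - 1) * (1 - x ^ p) ^ (v - 1) =
      ProbabilityTheory.beta u v / p := by
  have h := integral_comp_rpow_Ioi_of_pos
    (g := (Ioo 0 1).indicator (fun y : ℝ ↦ y ^ (u - 1) * (1 - y) ^ (v - 1))) hp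
  rw [setIntegral_congr_fun measurableSet_Ioi (fun x hx ↦ indicator_beta_comp_rpow hp u v hx),
    setIntegral_indicator measurableSet_Ioo, setIntegral_indicator measurableSet_Ioo,
    inter_eq_self_of_subset_right Ioo_subset_Ioi_self, integral_const_mul,
    integral_beta hu hv] at h
  rw [← h]
  field_simp

/-- Γ(s + 1 + n) / Γ(s + 1) as a polynomial in k, where s = (β + k) / r. -/
noncomputable def gammaRatioPoly (r n : ℕ) (β : ℝ) : Polynomial ℝ :=
  ∏ j ∈ Finset.range n, (Polynomial.C ((r : ℝ)⁻¹) * Polynomial.X + Polynomial.C (β / r + 1 + j))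

theorem natDegree_gammaRatioPoly_le (r n : ℕ) (β : ℝ) : (gammaRatioPoly r n β).natDegree ≤ n := by
  refine (Polynomial.natDegree_prod_le _ _).trans ?_
  refine (Finset.sum_le_card_nsmul _ _ 1 fun j _ ↦ Polynomial.natDegree_linear_le).trans ?_
  simp

theorem eval_gammaRatioPoly (r n : ℕ) (β x : ℝ) :
    (gammaRatioPoly r n β).eval x = ∏ j ∈ Finset.range n, ((β + x) / r + 1 + j) := by
  rw [gammaRatioPoly, Polynomial.eval_prod]
  refine Finset.prod_congr rfl fun j _ ↦ ?_
  simp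
  ring

theorem eval_neg_gammaRatioPoly {r : ℕ} (hr : 1 ≤ r) (n : ℕ) {α : ℝ} (β : ℝ) (hα : -1 < α) :
    (gammaRatioPoly r n β).eval (-((r : ℝ) * n + r * α + β + r)) =
      (-1) ^ n * (Real.Gamma (n + α + 1) / Real.Gamma (α + 1)) := by
  have hr' : (r : ℝ) ≠ 0 := by positivity
  have hα' : 0 < α + 1 := by linarith
  have := (Real.Gamma_pos_of_pos hα').ne'
  rw [eval_gammaRatioPoly, show (n : ℝ) + α + 1 = α + 1 + n by ring,
    Real.Gamma_add_nat_eq_prod_mul hα', mul_div_cancel_right₀ _ this,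
    ← Finset.prod_range_reflect (fun j : ℕ ↦ α + 1 + (j : ℝ)), ← Finset.card_range n,
    ← Finset.prod_const, Finset.card_range, ← Finset.prod_mul_distrib]
  refine Finset.prod_congr rfl fun j hj ↦ ?_
  have hj := Finset.mem_range.1 hj
  rw [Nat.cast_sub (by omega), Nat.cast_sub (by omega)]
  push_cast
  field_simp
  ring

theorem neg_one_lt_add_nat_div {r : ℕ} (hr : 1 ≤ r) {β : ℝ} (hβ : -1 < β) (k : ℕ) :
    -1 < (β + k) / r := by
  have hr' : (1 : ℝ) ≤ r := by exact_mod_cast hr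
  rw [lt_div_iff₀ (by linarith)]
  have : (0 : ℝ) ≤ k := by positivity
  linarith

open MeasureTheory Set in
theorem integral_jacAng {r : ℕ} (hr : 1 ≤ r) {α β : ℝ} (hα : -1 < α) (hβ : -1 < β) (n : ℕ) :
    ∫ x in (0:ℝ)..1, x ^ (r * (n + 1) - 1) * jacAng r n α β x * x ^ β * (1 - x ^ r) ^ α =
      ∑ k ∈ Finset.range (n + 1), (n.choose k : ℝ) *
        (Real.Gamma (n + α + (β + k) / r + 1) /
          (Real.Gamma (n + α + 1) * Real.Gamma ((β + k) / r + 1))) * (-1) ^ (n - k) *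
        (ProbabilityTheory.beta ((β + k) / r + 1 + n) (α + 1) / r) := by
  have hr0 : (0 : ℝ) < r := by positivity
  have hα' : 0 < α + 1 := by linarith
  have hs (k : ℕ) : 0 < (β + k) / r + 1 + n := by
    have := neg_one_lt_add_nat_div hr hβ k
    have : (0 : ℝ) ≤ n := by positivity
    linarith
  rw [intervalIntegral.integral_of_le zero_le_one, integral_Ioc_eq_integral_Ioo]
  simp_rw [← integral_beta_rpow hr0 (hs _) hα', ← integral_const_mul]
  rw [← integral_finsetSum _ fun k _ ↦ (integrableOn_beta_rpow hr0 (hs k) hα').const_mul _]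
  refine setIntegral_congr_fun measurableSet_Ioo fun x hx ↦ ?_
  simp only [jacAng, Finset.mul_sum, Finset.sum_mul]
  refine Finset.sum_congr rfl fun k _ ↦ ?_
  have hpow : x ^ (r * ((β + k) / r + 1 + n) - 1) = x ^ (r * (n + 1) - 1) * x ^ k * x ^ β := by
    have h1 : 1 ≤ r * (n + 1) := Nat.mul_pos hr n.succ_pos
    rw [← Real.rpow_natCast, ← Real.rpow_natCast, ← Real.rpow_add hx.1, ← Real.rpow_add hx.1,
      Nat.cast_sub h1]
    congr 1
    push_cast
    field_simp
    ring
  rw [hpow, Real.rpow_natCast, add_sub_cancel_right]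
  ring

/-- For r ≥ 1, α, β > −1, n ≥ 0,
∫_0^1 x^{r(n+1)−1} p_n(x; α, β) x^β (1−x^r)^α dx = n! / (rn+rα+β+r)_{n+1}. -/
theorem jacAng_normalization
    (r : ℕ) (hr : 1 ≤ r) (α β : ℝ) (hα : -1 < α) (hβ : -1 < β) (n : ℕ) :
    ∫ x in (0:ℝ)..1, x ^ (r * (n + 1) - 1) * jacAng r n α β x * x ^ β * (1 - x ^ r) ^ α
      = (n.factorial : ℝ) / poch ((r : ℝ) * n + r * α + β + r) (n + 1) := by
  rw [integral_jacAng hr hα hβ]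
  have hr1 : (1 : ℝ) ≤ r := by exact_mod_cast hr
  have hr0 : (0 : ℝ) < r := by linarith
  have hα' : 0 < α + 1 := by linarith
  have hΓα := (Real.Gamma_pos_of_pos hα').ne'
  have hn0 : (0 : ℝ) ≤ n := n.cast_nonneg
  have hΓn := (Real.Gamma_pos_of_pos (by linarith : 0 < n + α + 1)).ne'
  set a : ℝ := r * n + r * α + β + r with ha
  have hra : 0 < r * (α + 1) := by positivity
  have key (k : ℕ) : (n.choose k : ℝ) *
        (Real.Gamma (n + α + (β + k) / r + 1) /
          (Real.Gamma (n + α + 1) * Real.Gamma ((β + k) / r + 1))) * (-1) ^ (n - k) *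
        (ProbabilityTheory.beta ((β + k) / r + 1 + n) (α + 1) / r) =
      Real.Gamma (α + 1) / Real.Gamma (n + α + 1) *
        ((-1) ^ (n - k) * (n.choose k : ℝ) *
          ((gammaRatioPoly r n β).eval (k : ℝ) * (k + a)⁻¹)) := by
    have hs := neg_one_lt_add_nat_div hr hβ k
    have hΓs := (Real.Gamma_pos_of_pos (by linarith : 0 < (β + k) / r + 1)).ne'
    have hd : -1 < n + α + (β + k) / r + 1 := by linarith
    have hda : (k + a)⁻¹ = (n + α + (β + k) / r + 1)⁻¹ / r := by
      rw [div_eq_mul_inv, ← mul_inv]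
      congr 1
      rw [ha]
      field_simp
      ring
    rw [hda, ← Real.Gamma_div_Gamma_add_one hd, ProbabilityTheory.beta,
      Real.Gamma_add_nat_eq_prod_mul (by linarith : 0 < (β + k) / r + 1), eval_gammaRatioPoly,
      show (β + k) / r + 1 + n + (α + 1) = n + α + (β + k) / r + 1 + 1 by ring]
    generalize (β + k) / r = s at *
    field_simp
  simp_rw [key, ← Finset.mul_sum]
  rw [poch, div_div_eq_mul_div]
  rcases eq_or_ne n 0 with rfl | hn
  · have ha1 : -1 < a := by rw [ha]; push_cast; linarith
    simp [gammaRatioPoly, Real.Gamma_div_Gamma_add_one ha1, hΓα]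
  · have hn1 : (1 : ℝ) ≤ n := by exact_mod_cast Nat.one_le_iff_ne_zero.2 hn
    have ha0 : 0 < a := by
      have : (1 : ℝ) ≤ r * n := one_le_mul_of_one_le_of_one_le hr1 hn1
      rw [ha]; linarith
    rw [sum_choose_mul_eval_div_add hn _ (natDegree_gammaRatioPoly_le r n β) ha0,
      eval_neg_gammaRatioPoly hr n β hα]
    have h1 : ((-1 : ℝ) ^ n) * (-1) ^ n = 1 := by rw [← mul_pow]; simp
    have h2 : Real.Gamma (α + 1) / Real.Gamma (n + α + 1) *
        (Real.Gamma (n + α + 1) / Real.Gamma (α + 1)) = 1 := by field_simp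
    generalize n.factorial * Real.Gamma a / Real.Gamma (a + (n + 1 : ℕ)) = t
    linear_combination t * ((-1) ^ n * (-1) ^ n) * h2 + t * h1
end

section
/- Let α, β > −1 be real and n ≥ 1 an integer. Define λ_{n,n} = (1/2) · (2n+2α+β)_n/(n−1)! · Γ(n+α+(β+n−1)/2) / (Γ(n+α) Γ((β+n+1)/2)) (the leading coefficient of the diagonal type I polynomial B_{n,n}) and λ_{n,n+1} = [Γ(n+α+(β+n+1)/2) / (Γ(n+α+1) Γ((β+n+1)/2))] · (2n+2α+β+1)_{n+1}/n! (the leading coefficient of the off-diagonal type I polynomial B_{n,n+1}). Then λ_{n,n} / λ_{n,n+1} = n(n+α)(2n+2α+β) / [(3n+2α+β+1)(3n+2α+β)(3n+2α+β−1)]. (This is the nearest-neighbor recurrence coefficient a_{n,n} = b_{n,n} for the type I Jacobi-Angelesco polynomials with r = 2.) -/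
/-- the ratio of the leading coefficients λ_{n,n} and λ_{n,n+1} of the type I
Jacobi-Angelesco polynomials with r = 2 gives the nearest-neighbor recurrence coefficient
a_{n,n} = b_{n,n}. -/
theorem jacobiAngelesco_recurrence_coefficient
    (α β : ℝ) (hα : -1 < α) (hβ : -1 < β) (n : ℕ) (hn : 1 ≤ n) :
    ((1 / 2) * poch (2 * n + 2 * α + β) n / (n - 1).factorial *
        (Real.Gamma (n + α + (β + n - 1) / 2) /
          (Real.Gamma (n + α) * Real.Gamma ((β + n + 1) / 2)))) /
      ((Real.Gamma (n + α + (β + n + 1) / 2) /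
          (Real.Gamma (n + α + 1) * Real.Gamma ((β + n + 1) / 2))) *
        poch (2 * n + 2 * α + β + 1) (n + 1) / n.factorial)
      = n * (n + α) * (2 * n + 2 * α + β) /
          ((3 * n + 2 * α + β + 1) * (3 * n + 2 * α + β) * (3 * n + 2 * α + β - 1)) := by
  obtain ⟨k, rfl⟩ : ∃ k, n = k + 1 := ⟨n - 1, by omega⟩
  have hk : (0 : ℝ) ≤ k := k.cast_nonneg
  unfold poch
  rw [Nat.add_sub_cancel, Nat.factorial_succ]
  push_cast
  rcases eq_or_ne (2 * ((k : ℝ) + 1) + 2 * α + β) 0 with hA | hA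
  · simp [hA]
  have hX : 3 * ((k : ℝ) + 1) + 2 * α + β - 1 ≠ 0 := by
    rcases Nat.eq_zero_or_pos k with rfl | hpos
    · intro h
      apply hA
      push_cast at h ⊢
      linarith
    · have : (1 : ℝ) ≤ k := by exact_mod_cast hpos
      apply ne_of_gt
      linarith
  have hfact : (k.factorial : ℝ) ≠ 0 := by exact_mod_cast k.factorial_ne_zero
  have gA := Real.Gamma_add_one hA
  have gX := Real.Gamma_add_one (s := 3 * ((k : ℝ) + 1) + 2 * α + β) (by linarith)
  have gX1 := Real.Gamma_add_one (s := 3 * ((k : ℝ) + 1) + 2 * α + β + 1) (by linarith)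
  have gH := Real.Gamma_add_one (s := (3 * ((k : ℝ) + 1) + 2 * α + β - 1) / 2)
    (div_ne_zero hX two_ne_zero)
  have gα := Real.Gamma_add_one (s := (k : ℝ) + 1 + α) (by linarith)
  have pA := (Real.Gamma_pos_of_pos
    (s := 2 * ((k : ℝ) + 1) + 2 * α + β + 1) (by linarith)).ne'
  have pX := (Real.Gamma_pos_of_pos (s := 3 * ((k : ℝ) + 1) + 2 * α + β) (by linarith)).ne'
  have pH := (Real.Gamma_pos_of_pos
    (s := (3 * ((k : ℝ) + 1) + 2 * α + β - 1) / 2 + 1) (by linarith)).ne'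
  have pα := (Real.Gamma_pos_of_pos (s := (k : ℝ) + 1 + α) (by linarith)).ne'
  have pβ := (Real.Gamma_pos_of_pos (s := (β + ((k : ℝ) + 1) + 1) / 2) (by linarith)).ne'
  have nα : (k : ℝ) + 1 + α ≠ 0 := by linarith
  have nk : (k : ℝ) + 1 ≠ 0 := by linarith
  have nX : 3 * ((k : ℝ) + 1) + 2 * α + β ≠ 0 := by linarith
  have nX1 : 3 * ((k : ℝ) + 1) + 2 * α + β + 1 ≠ 0 := by linarith
  rw [gA] at pA
  rw [gH] at pH
  have pA' := right_ne_zero_of_mul pA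
  have pH' := right_ne_zero_of_mul pH
  rw [show 2 * ((k : ℝ) + 1) + 2 * α + β + 1 + ((k : ℝ) + 1 + 1)
        = 3 * ((k : ℝ) + 1) + 2 * α + β + 1 + 1 by ring,
    show 2 * ((k : ℝ) + 1) + 2 * α + β + ((k : ℝ) + 1)
        = 3 * ((k : ℝ) + 1) + 2 * α + β by ring,
    show (k : ℝ) + 1 + α + (β + ((k : ℝ) + 1) - 1) / 2
        = (3 * ((k : ℝ) + 1) + 2 * α + β - 1) / 2 by ring,
    show (k : ℝ) + 1 + α + (β + ((k : ℝ) + 1) + 1) / 2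
        = (3 * ((k : ℝ) + 1) + 2 * α + β - 1) / 2 + 1 by ring,
    gX1, gX, gA, gH, gα]
  generalize Real.Gamma (2 * ((k : ℝ) + 1) + 2 * α + β) = GA at *
  generalize Real.Gamma (3 * ((k : ℝ) + 1) + 2 * α + β) = GX at *
  generalize Real.Gamma ((3 * ((k : ℝ) + 1) + 2 * α + β - 1) / 2) = GH at *
  generalize Real.Gamma ((k : ℝ) + 1 + α) = Ga at *
  generalize Real.Gamma ((β + ((k : ℝ) + 1) + 1) / 2) = Gb at *
  generalize 2 * ((k : ℝ) + 1) + 2 * α + β = A at *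
  generalize 3 * ((k : ℝ) + 1) + 2 * α + β = X at *
  field_simp
end

section
/- Let α, β > 1 be real and n ≥ 0 an integer. Then, with r = 2, the following polynomial identity holds for all real x: (β(1−x^2) − 2αx^2) p_n(x; α, β) + x(1−x^2) p_n'(x; α, β) = (2n+2α+β) p_{n+2}(x; α−2, β−2) − (3n+4α+2β) x p_{n+1}(x; α−1, β−1). Equivalently, for 0 < x < 1, d/dx [ x^β (1−x^2)^α p_n(x; α, β) ] = x^{β−1}(1−x^2)^{α−1} [ (2n+2α+β) p_{n+2}(x; α−2, β−2) − (3n+4α+2β) x p_{n+1}(x; α−1, β−1) ]. -/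
/-- The factor common to the coefficients of `x ^ k` on both sides of the raising identity. -/
noncomputable def jacAngWeight (n : ℕ) (α β : ℝ) (k : ℕ) : ℝ :=
  Real.Gamma (n + α + (β + k) / 2) /
    (Real.Gamma (n + α + 1) * Real.Gamma ((β + k) / 2)) * (-1) ^ (n + k)

lemma neg_one_pow_sub_eq_add {n k : ℕ} (h : k ≤ n) : (-1 : ℝ) ^ (n - k) = (-1) ^ (n + k) := by
  obtain ⟨m, rfl⟩ := Nat.exists_eq_add_of_le h
  rw [Nat.add_sub_cancel_left, show k + m + k = m + 2 * k by ring, pow_add, pow_mul]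
  simp

lemma jacAng_two_eq_sum_weight (n : ℕ) (α β x : ℝ) :
    jacAng 2 n α β x =
      ∑ k ∈ Finset.range (n + 1), n.choose k * jacAngWeight n α β (k + 2) * x ^ k := by
  refine Finset.sum_congr rfl fun k hk => ?_
  rw [neg_one_pow_sub_eq_add (Nat.lt_succ_iff.1 (Finset.mem_range.1 hk)), jacAngWeight,
    ← add_assoc n k 2, pow_add _ (n + k) 2]
  push_cast
  rw [show (β + (k + 2)) / 2 = (β + k) / 2 + 1 by ring, ← add_assoc]
  ring

lemma jacAng_two_add_two_eq_sum_weight (n : ℕ) (α β x : ℝ) :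
    jacAng 2 (n + 2) (α - 2) (β - 2) x =
      ∑ k ∈ Finset.range (n + 3), (n + 2).choose k * jacAngWeight n α β k * x ^ k := by
  refine Finset.sum_congr rfl fun k hk => ?_
  rw [neg_one_pow_sub_eq_add (Nat.lt_succ_iff.1 (Finset.mem_range.1 hk)), jacAngWeight,
    add_right_comm n 2 k, pow_add _ (n + k) 2]
  push_cast
  rw [show (n + 2 + (α - 2) + (β - 2 + k) / 2 + 1 : ℝ) = n + α + (β + k) / 2 by ring,
    show (n + 2 + (α - 2) + 1 : ℝ) = n + α + 1 by ring,
    show ((β - 2 + k) / 2 + 1 : ℝ) = (β + k) / 2 by ring]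
  ring

lemma jacAng_two_add_one_eq_sum_weight (n : ℕ) (α β x : ℝ) :
    jacAng 2 (n + 1) (α - 1) (β - 1) x =
      ∑ k ∈ Finset.range (n + 2), (n + 1).choose k * jacAngWeight n α β (k + 1) * x ^ k := by
  refine Finset.sum_congr rfl fun k hk => ?_
  rw [neg_one_pow_sub_eq_add (Nat.lt_succ_iff.1 (Finset.mem_range.1 hk)), jacAngWeight,
    add_assoc n 1 k, add_comm 1 k]
  push_cast
  rw [show (n + 1 + (α - 1) + (β - 1 + k) / 2 + 1 : ℝ) = n + α + (β + (k + 1)) / 2 by ring,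
    show (n + 1 + (α - 1) + 1 : ℝ) = n + α + 1 by ring,
    show ((β - 1 + k) / 2 + 1 : ℝ) = (β + (k + 1)) / 2 by ring]
  ring

lemma add_mul_jacAngWeight_add_two {α β : ℝ} (hα : 0 < α) (hβ : 0 < β) (n k : ℕ) :
    (β + k) * jacAngWeight n α β (k + 2) =
      (2 * n + 2 * α + β + k) * jacAngWeight n α β k := by
  have hs : (β + k) / 2 ≠ 0 := by positivity
  have hN : n + α + (β + k) / 2 ≠ 0 := by positivity
  have hG : Real.Gamma ((β + k) / 2) ≠ 0 := (Real.Gamma_pos_of_pos (by positivity)).ne'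
  have hG' : Real.Gamma (n + α + 1) ≠ 0 := (Real.Gamma_pos_of_pos (by positivity)).ne'
  rw [jacAngWeight, jacAngWeight, ← add_assoc n k 2, pow_add _ (n + k) 2]
  push_cast
  rw [show (β + (k + 2)) / 2 = (β + k) / 2 + 1 by ring, ← add_assoc,
    Real.Gamma_add_one hs, Real.Gamma_add_one hN]
  field_simp
  ring

lemma hasDerivAt_jacAng_two (n : ℕ) (α β x : ℝ) :
    HasDerivAt (jacAng 2 n α β)
      (∑ k ∈ Finset.range (n + 1),
        n.choose k * jacAngWeight n α β (k + 2) * (k * x ^ (k - 1))) x := by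
  rw [funext (jacAng_two_eq_sum_weight n α β)]
  exact HasDerivAt.fun_sum fun k _ => (hasDerivAt_pow k x).const_mul _

lemma mul_deriv_jacAng_two (n : ℕ) (α β x : ℝ) :
    x * deriv (jacAng 2 n α β) x =
      ∑ k ∈ Finset.range (n + 1), k * (n.choose k * jacAngWeight n α β (k + 2) * x ^ k) := by
  rw [(hasDerivAt_jacAng_two n α β x).deriv, Finset.mul_sum]
  refine Finset.sum_congr rfl fun k _ => ?_
  cases k with
  | zero => simp
  | succ k => rw [Nat.add_sub_cancel, pow_succ]; ring

lemma cast_choose_succ_mul (n k : ℕ) :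
    (n.choose (k + 1) : ℝ) * (k + 1) = n.choose k * (n - k) := by
  rcases le_or_gt k n with h | h
  · rw [← Nat.cast_sub h]
    exact_mod_cast Nat.choose_succ_right_eq n k
  · simp [Nat.choose_eq_zero_of_lt h, Nat.choose_eq_zero_of_lt (h.trans k.lt_succ_self)]

/-- The polynomial form of the raising identity. -/
lemma jacAng_two_raising {α β : ℝ} (hα : 0 < α) (hβ : 0 < β) (n : ℕ) (x : ℝ) :
    (β * (1 - x ^ 2) - 2 * α * x ^ 2) * jacAng 2 n α β x
        + x * (1 - x ^ 2) * deriv (jacAng 2 n α β) x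
      = (2 * n + 2 * α + β) * jacAng 2 (n + 2) (α - 2) (β - 2) x
        - (3 * n + 4 * α + 2 * β) * x * jacAng 2 (n + 1) (α - 1) (β - 1) x := by
  have lower : β * jacAng 2 n α β x + x * deriv (jacAng 2 n α β) x =
      ∑ k ∈ Finset.range (n + 3),
        n.choose k * (2 * n + 2 * α + β + k) * jacAngWeight n α β k * x ^ k := by
    rw [Finset.sum_range_succ _ (n + 2), Finset.sum_range_succ _ (n + 1),
      Nat.choose_eq_zero_of_lt (by lia : n < n + 1),
      Nat.choose_eq_zero_of_lt (by lia : n < n + 2),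
      mul_deriv_jacAng_two, jacAng_two_eq_sum_weight, Finset.mul_sum, ← Finset.sum_add_distrib]
    simp only [Nat.cast_zero, zero_mul, add_zero]
    refine Finset.sum_congr rfl fun k _ => ?_
    linear_combination (n.choose k * x ^ k : ℝ) * add_mul_jacAngWeight_add_two hα hβ n k
  have upper : (2 * α + β) * jacAng 2 n α β x + x * deriv (jacAng 2 n α β) x =
      ∑ k ∈ Finset.range (n + 1),
        n.choose k * (2 * α + β + k) * jacAngWeight n α β (k + 2) * x ^ k := by
    rw [mul_deriv_jacAng_two, jacAng_two_eq_sum_weight, Finset.mul_sum, ← Finset.sum_add_distrib]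
    exact Finset.sum_congr rfl fun k _ => by ring
  trans (β * jacAng 2 n α β x + x * deriv (jacAng 2 n α β) x) -
    x ^ 2 * ((2 * α + β) * jacAng 2 n α β x + x * deriv (jacAng 2 n α β) x)
  · ring
  rw [lower, upper, jacAng_two_add_two_eq_sum_weight, jacAng_two_add_one_eq_sum_weight,
    Finset.sum_range_succ' _ (n + 2), Finset.sum_range_succ' _ (n + 1),
    Finset.sum_range_succ' _ (n + 2), Finset.sum_range_succ' _ (n + 1),
    Finset.sum_range_succ' _ (n + 1)]
  have tail : ∑ k ∈ Finset.range (n + 1), n.choose (k + 1 + 1) *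
        (2 * n + 2 * α + β + (k + 1 + 1 : ℕ)) * jacAngWeight n α β (k + 1 + 1) * x ^ (k + 1 + 1)
      - x ^ 2 * ∑ k ∈ Finset.range (n + 1),
        n.choose k * (2 * α + β + k) * jacAngWeight n α β (k + 2) * x ^ k =
      (2 * n + 2 * α + β) * ∑ k ∈ Finset.range (n + 1), (n + 2).choose (k + 1 + 1) *
        jacAngWeight n α β (k + 1 + 1) * x ^ (k + 1 + 1)
      - (3 * n + 4 * α + 2 * β) * x * ∑ k ∈ Finset.range (n + 1), (n + 1).choose (k + 1) *
        jacAngWeight n α β (k + 1 + 1) * x ^ (k + 1) := by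
    simp only [Finset.mul_sum, ← Finset.sum_sub_distrib]
    refine Finset.sum_congr rfl fun k _ => ?_
    have h₁ := cast_choose_succ_mul n k
    have h₂ := cast_choose_succ_mul n (k + 1)
    simp only [Nat.choose_succ_succ' (n + 1) (k + 1), Nat.choose_succ_succ' n (k + 1),
      Nat.choose_succ_succ' n k]
    push_cast at h₂ ⊢
    linear_combination (jacAngWeight n α β (k + 2) * x ^ (k + 2)) * (h₂ - h₁)
  simp only [zero_add, Nat.choose_zero_right, Nat.choose_one_right]
  push_cast at tail ⊢
  linear_combination tail

/-- the raising identity for p_n(x; α, β) with r = 2: the polynomial identity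
(β(1−x²) − 2αx²) p_n(x;α,β) + x(1−x²) p_n'(x;α,β)
  = (2n+2α+β) p_{n+2}(x;α−2,β−2) − (3n+4α+2β) x p_{n+1}(x;α−1,β−1),
and, equivalently, on (0,1),
d/dx [x^β (1−x²)^α p_n(x;α,β)] = x^{β−1}(1−x²)^{α−1} [(2n+2α+β) p_{n+2}(x;α−2,β−2)
  − (3n+4α+2β) x p_{n+1}(x;α−1,β−1)]. -/
theorem jacAng_raising_r_two
    (α β : ℝ) (hα : 1 < α) (hβ : 1 < β) (n : ℕ) :
    (∀ x : ℝ,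
      (β * (1 - x ^ 2) - 2 * α * x ^ 2) * jacAng 2 n α β x
        + x * (1 - x ^ 2) * deriv (jacAng 2 n α β) x
      = (2 * n + 2 * α + β) * jacAng 2 (n + 2) (α - 2) (β - 2) x
        - (3 * n + 4 * α + 2 * β) * x * jacAng 2 (n + 1) (α - 1) (β - 1) x) ∧
    (∀ x ∈ Set.Ioo (0:ℝ) 1,
      HasDerivAt (fun y : ℝ => y ^ β * (1 - y ^ 2) ^ α * jacAng 2 n α β y)
        (x ^ (β - 1) * (1 - x ^ 2) ^ (α - 1) *
          ((2 * n + 2 * α + β) * jacAng 2 (n + 2) (α - 2) (β - 2) x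
            - (3 * n + 4 * α + 2 * β) * x * jacAng 2 (n + 1) (α - 1) (β - 1) x)) x) := by
  have hα₀ : 0 < α := one_pos.trans hα
  have hβ₀ : 0 < β := one_pos.trans hβ
  refine ⟨jacAng_two_raising hα₀ hβ₀ n, fun x hx => ?_⟩
  have hx₁ : 0 < 1 - x ^ 2 := by nlinarith [hx.1, hx.2]
  have hp := (hasDerivAt_jacAng_two n α β x).differentiableAt.hasDerivAt
  have hb := Real.hasDerivAt_rpow_const (p := β) (Or.inl hx.1.ne')
  have ha := ((hasDerivAt_pow 2 x).const_sub 1).rpow_const (p := α) (Or.inl hx₁.ne')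
  refine ((hb.fun_mul ha).fun_mul hp).congr_deriv ?_
  rw [← jacAng_two_raising hα₀ hβ₀ n x]
  have hxβ : x ^ β = x ^ (β - 1) * x := by
    rw [← Real.rpow_add_one hx.1.ne', sub_add_cancel]
  have hxα : (1 - x ^ 2) ^ α = (1 - x ^ 2) ^ (α - 1) * (1 - x ^ 2) := by
    rw [← Real.rpow_add_one hx₁.ne', sub_add_cancel]
  simp only [hxβ, hxα]
  push_cast
  ring
end

section
/- Let α, β > −1 be real and n ≥ 0 an integer. With r = 2, the polynomial y(x) = p_n(x; α, β) satisfies the third order differential equation x(1−x^2) y'''(x) + (β+2 − (2α+β+6)x^2) y''(x) + (n−1)(3n+4α+2β+6) x y'(x) = n(n−1)(2n+2α+β+2) y(x) for all real x. -/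
open Polynomial in
/-- A real polynomial whose coefficients satisfy the two-step recurrence
`(k+2)(k+1)(k+β+2) c_{k+2} = (n-k)(n-k-1)(2n+2α+β+k+2) c_k` solves the third order equation. -/
theorem Polynomial.third_order_ode_of_coeff_recurrence (P : ℝ[X]) (α β n x : ℝ)
    (hP : ∀ k : ℕ, ((k : ℝ) + 2) * (k + 1) * (k + β + 2) * P.coeff (k + 2)
      = (n - k) * (n - k - 1) * (2 * n + 2 * α + β + k + 2) * P.coeff k) :
    x * (1 - x ^ 2) * P.derivative.derivative.derivative.eval x
      + (β + 2 - (2 * α + β + 6) * x ^ 2) * P.derivative.derivative.eval x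
      + (n - 1) * (3 * n + 4 * α + 2 * β + 6) * x * P.derivative.eval x
      = n * (n - 1) * (2 * n + 2 * α + β + 2) * P.eval x := by
  have key : X * P.derivative.derivative.derivative
      - X ^ 3 * P.derivative.derivative.derivative
      + C (β + 2) * P.derivative.derivative
      - C (2 * α + β + 6) * (X ^ 2 * P.derivative.derivative)
      + C ((n - 1) * (3 * n + 4 * α + 2 * β + 6)) * (X * P.derivative)
      = C (n * (n - 1) * (2 * n + 2 * α + β + 2)) * P := by
    ext d
    have h := hP d
    rcases d with _ | _ | _ | d <;>
      simp only [coeff_add, coeff_sub, coeff_C_mul, coeff_X_mul, coeff_X_mul_zero,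
        coeff_X_pow_mul', coeff_derivative] at h ⊢
    iterate 3
      norm_num at h ⊢
      linear_combination h
    rw [show d + 1 + 1 + 1 - 3 = d by omega, show d + 1 + 1 + 1 - 2 = d + 1 by omega,
      if_pos (by omega), if_pos (by omega)]
    push_cast at h ⊢
    linear_combination h
  have h := congrArg (eval x) key
  simp only [eval_add, eval_sub, eval_mul, eval_X, eval_pow, eval_C] at h
  linear_combination h

/-- The coefficients of `jacAng 2 n α β` satisfy a two-step recurrence. -/
theorem jacAng_coeff_recurrence {α β : ℝ} (hα : -1 < α) (hβ : -1 < β) (n k : ℕ) :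
    ((k : ℝ) + 2) * (k + 1) * (k + β + 2) * ((n.choose (k + 2) : ℝ) *
      (Real.Gamma (n + α + (β + (k + 2 : ℕ)) / (2 : ℕ) + 1) /
        (Real.Gamma (n + α + 1) * Real.Gamma ((β + (k + 2 : ℕ)) / (2 : ℕ) + 1))) *
      (-1) ^ (n - (k + 2)))
    = (n - k) * (n - k - 1) * (2 * n + 2 * α + β + k + 2) * ((n.choose k : ℝ) *
      (Real.Gamma (n + α + (β + k) / (2 : ℕ) + 1) /
        (Real.Gamma (n + α + 1) * Real.Gamma ((β + k) / (2 : ℕ) + 1))) *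
      (-1) ^ (n - k)) := by
  rcases lt_or_ge n (k + 2) with hn | hn
  · rw [Nat.choose_eq_zero_of_lt hn]
    rcases lt_or_ge n k with hk | hk
    · simp [Nat.choose_eq_zero_of_lt hk]
    · obtain rfl | rfl : n = k ∨ n = k + 1 := by omega
      · simp
      · simp
  · obtain ⟨m, rfl⟩ := Nat.exists_eq_add_of_le hn
    have hm : (0 : ℝ) ≤ m := m.cast_nonneg
    have hk : (0 : ℝ) ≤ k := k.cast_nonneg
    have hc₁ := Nat.choose_succ_right_eq (k + 2 + m) (k + 1)
    have hc₂ := Nat.choose_succ_right_eq (k + 2 + m) k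
    rw [show k + 2 + m - (k + 1) = m + 1 by omega] at hc₁
    rw [show k + 2 + m - k = m + 2 by omega] at hc₂
    have hc₁' := congrArg (Nat.cast (R := ℝ)) hc₁
    have hc₂' := congrArg (Nat.cast (R := ℝ)) hc₂
    rw [show k + 2 + m - (k + 2) = m by omega, show k + 2 + m - k = m + 2 by omega]
    push_cast at hc₁' hc₂' ⊢
    set b : ℝ := (β + k) / 2 + 1 with hb
    set a : ℝ := k + 2 + m + α + (β + k) / 2 + 1 with ha
    have hb₀ : 0 < b := by rw [hb]; linarith
    have ha₀ : 0 < a := by rw [ha]; linarith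
    rw [show (k : ℝ) + 2 + m + α + (β + (k + 2)) / 2 + 1 = a + 1 by rw [ha]; ring,
      show (β + ((k : ℝ) + 2)) / 2 + 1 = b + 1 by rw [hb]; ring,
      Real.Gamma_add_one ha₀.ne', Real.Gamma_add_one hb₀.ne']
    have hΓb := (Real.Gamma_pos_of_pos hb₀).ne'
    have hΓ : Real.Gamma (k + 2 + m + α + 1) ≠ 0 :=
      (Real.Gamma_pos_of_pos (by linarith)).ne'
    rw [show (k : ℝ) + β + 2 = 2 * b by rw [hb]; ring,
      show 2 * ((k : ℝ) + 2 + m) + 2 * α + β + k + 2 = 2 * a by rw [ha]; ring]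
    have hc : ((k : ℝ) + 2) * (k + 1) * ((k + 2 + m).choose (k + 2) : ℝ)
        = (m + 2) * (m + 1) * ((k + 2 + m).choose k : ℝ) := by
      linear_combination ((k : ℝ) + 1) * hc₁' + ((m : ℝ) + 1) * hc₂'
    clear_value a b
    field_simp
    linear_combination (-1 : ℝ) ^ m * hc

/-- with r = 2 the polynomial y = p_n(x; α, β) satisfies the third order ODE
x(1−x²) y''' + (β+2 − (2α+β+6)x²) y'' + (n−1)(3n+4α+2β+6) x y' = n(n−1)(2n+2α+β+2) y. -/
theorem jacAng_third_order_ode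
    (α β : ℝ) (hα : -1 < α) (hβ : -1 < β) (n : ℕ) (x : ℝ) :
    x * (1 - x ^ 2) * iteratedDeriv 3 (jacAng 2 n α β) x
      + (β + 2 - (2 * α + β + 6) * x ^ 2) * iteratedDeriv 2 (jacAng 2 n α β) x
      + ((n : ℝ) - 1) * (3 * n + 4 * α + 2 * β + 6) * x * deriv (jacAng 2 n α β) x
      = n * ((n : ℝ) - 1) * (2 * n + 2 * α + β + 2) * jacAng 2 n α β x := by
  set P : Polynomial ℝ := ∑ k ∈ Finset.range (n + 1), Polynomial.monomial k
    ((n.choose k : ℝ) * (Real.Gamma (n + α + (β + k) / (2 : ℕ) + 1) /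
      (Real.Gamma (n + α + 1) * Real.Gamma ((β + k) / (2 : ℕ) + 1))) * (-1) ^ (n - k)) with hP
  have hfun : jacAng 2 n α β = fun x => P.eval x := by
    funext x
    simp only [jacAng, hP, Polynomial.eval_finsetSum, Polynomial.eval_monomial]
  have hderiv (Q : Polynomial ℝ) : deriv (fun x => Q.eval x) = fun x => Q.derivative.eval x :=
    funext fun x => Q.deriv
  have hcoeff (k : ℕ) : P.coeff k = (n.choose k : ℝ) *
      (Real.Gamma (n + α + (β + k) / (2 : ℕ) + 1) /
        (Real.Gamma (n + α + 1) * Real.Gamma ((β + k) / (2 : ℕ) + 1))) * (-1) ^ (n - k) := by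
    simp only [hP, Polynomial.finsetSum_coeff, Polynomial.coeff_monomial, Finset.sum_ite_eq',
      Finset.mem_range]
    split_ifs with h
    · rfl
    · simp [Nat.choose_eq_zero_of_lt (show n < k by omega)]
  simp only [hfun, iteratedDeriv_succ, iteratedDeriv_zero, hderiv]
  refine P.third_order_ode_of_coeff_recurrence α β n x fun k => ?_
  rw [hcoeff, hcoeff]
  exact jacAng_coeff_recurrence hα hβ n k
end

section
/- Let r ≥ 1 be an integer, α, β > −1 real, and n ≥ 1 an integer. Then for all real x, p_n'(x; α, β) = n · p_{n−1}(x; α+1, β+1), where the derivative is with respect to x. -/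
/-- the lowering property p_n'(x; α, β) = n p_{n−1}(x; α+1, β+1). -/
theorem jacAng_deriv_eq
    (r : ℕ) (hr : 1 ≤ r) (α β : ℝ) (hα : -1 < α) (hβ : -1 < β)
    (n : ℕ) (hn : 1 ≤ n) (x : ℝ) :
    deriv (jacAng r n α β) x = n * jacAng r (n - 1) (α + 1) (β + 1) x := by
  obtain ⟨m, rfl⟩ := Nat.exists_eq_add_of_le' hn
  have h : HasDerivAt (jacAng r (m + 1) α β)
      (∑ k ∈ Finset.range (m + 1 + 1), ((m + 1).choose k : ℝ) *
        (Real.Gamma ((m + 1 : ℕ) + α + (β + k) / r + 1) /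
          (Real.Gamma ((m + 1 : ℕ) + α + 1) * Real.Gamma ((β + k) / r + 1))) *
        (-1) ^ (m + 1 - k) * (k * x ^ (k - 1))) x := by
    unfold jacAng
    exact HasDerivAt.fun_sum fun k _ => (hasDerivAt_pow k x).const_mul _
  rw [h.deriv, Finset.sum_range_succ', jacAng, Finset.mul_sum]
  simp only [Nat.cast_zero, zero_mul, mul_zero, add_zero, Nat.add_sub_cancel,
    Nat.add_sub_add_right]
  refine Finset.sum_congr rfl fun k _ => ?_
  have hchoose : ((m + 1 : ℕ) : ℝ) * (m.choose k : ℝ) =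
      ((m + 1).choose (k + 1) : ℝ) * ((k + 1 : ℕ) : ℝ) := by
    exact_mod_cast Nat.add_one_mul_choose_eq m k
  have hα' : (m : ℝ) + (α + 1) = ((m + 1 : ℕ) : ℝ) + α := by push_cast; ring
  have hβ' : β + 1 + (k : ℝ) = β + ((k + 1 : ℕ) : ℝ) := by push_cast; ring
  rw [hα', hβ']
  linear_combination (-(Real.Gamma ((m + 1 : ℕ) + α + (β + (k + 1 : ℕ)) / r + 1) /
    (Real.Gamma ((m + 1 : ℕ) + α + 1) * Real.Gamma ((β + (k + 1 : ℕ)) / r + 1)) *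
    (-1) ^ (m - k) * x ^ k)) * hchoose
end

section
/- Let r ≥ 2 be an integer, α, β > −1 real, and n ≥ 1 an integer. Let ω = exp(2πi/r). Define ν_n^{(α,β)} = Γ(n+α+(β+n)/r+1) / (Γ(n+α+1) Γ((β+n)/r+1)) and τ = r · n! · Γ(n+α+1) Γ((β+n+1)/r) Γ(rn+rα+β+1) / [ Γ(n+α+(β+n+1)/r) Γ(rn+n+rα+β+2) ]. For ℓ = 0, 1, …, r−1 define the complex polynomials A_ℓ(x) = (1/τ) ∑_{j=0}^{r−1} (ω^{ℓ j} / ν_n^{(α,β−j)}) p_n(x; α, β−j), and for k, j ∈ {1, …, r} set A_{k,j}(x) = A_{(j−k) mod r}(ω^{1−j} x) · ω^{1−k}. Then: (i) A_{k,j} has degree n if j = k and degree n−1 if j ≠ k; (ii) for every integer ℓ with 0 ≤ ℓ ≤ rn−1, ∑_{j=1}^{r} ω^{j−1} ∫_0^1 (ω^{j−1} t)^ℓ A_{k,j}(ω^{j−1} t) · t^β (1−t^r)^α dt = 0; (iii) for ℓ = rn this sum equals 1. (That is, (A_{k,1}, …, A_{k,r}) is the type I Jacobi-Angelesco vector for the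 multi-index (n,…,n) + e_k.) -/
/-- The polynomial p_n(x; α, β) on the r-star, extended to complex arguments. -/
noncomputable def jacAngC (r n : ℕ) (α β : ℝ) (z : ℂ) : ℂ :=
  ∑ k ∈ Finset.range (n + 1), (n.choose k : ℂ) *
    ((Real.Gamma (n + α + (β + k) / r + 1) /
      (Real.Gamma (n + α + 1) * Real.Gamma ((β + k) / r + 1)) : ℝ) : ℂ) *
    (-1) ^ (n - k) * z ^ k

section

open Polynomial MeasureTheory

theorem Real.Gamma_add_nat_eq_ascPochhammer {x : ℝ} (hx : 0 < x) (n : ℕ) :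
    Real.Gamma (x + n) = (ascPochhammer ℝ n).eval x * Real.Gamma x := by
  induction n with
  | zero => simp
  | succ n ih =>
    have h : x + n ≠ 0 := by positivity
    rw [ascPochhammer_succ_eval, Nat.cast_succ, ← add_assoc, Real.Gamma_add_one h, ih]
    ring

theorem sum_neg_one_pow_mul_choose_mul_eval_eq_zero {P : ℝ[X]} {n : ℕ} (hP : P.natDegree < n)
    (b h : ℝ) :
    ∑ k ∈ Finset.range (n + 1), (-1 : ℝ) ^ (n - k) * n.choose k * P.eval ((b + k) / h) = 0 := by
  have hQ : (P.comp (C h⁻¹ * (X + C b))).natDegree < n := by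
    refine (natDegree_comp_le.trans ?_).trans_lt hP
    have : (C h⁻¹ * (X + C b)).natDegree ≤ 1 := by compute_degree
    nlinarith
  have := congrFun (fwdDiff_iter_eq_zero_of_degree_lt hQ) 0
  rw [fwdDiff_iter_eq_sum_shift] at this
  rw [← this.trans (Pi.zero_apply _)]
  refine Finset.sum_congr rfl fun k _ => ?_
  simp [div_eq_inv_mul, add_comm]

theorem sum_neg_one_pow_mul_choose_div_add {x : ℝ} (hx : 0 < x) (n : ℕ) :
    ∑ k ∈ Finset.range (n + 1), (-1 : ℝ) ^ (n - k) * n.choose k / (x + k) =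
      (-1) ^ n * n.factorial / (ascPochhammer ℝ (n + 1)).eval x := by
  have key : ∀ y : ℝ, 0 < y → (fwdDiff (1 : ℝ))^[n] (fun z => z⁻¹) y =
      (-1) ^ n * n.factorial / (ascPochhammer ℝ (n + 1)).eval y := by
    clear hx x
    induction n with
    | zero => simp
    | succ n ih =>
      intro y hy
      have h1 : (ascPochhammer ℝ (n + 1)).eval y = y * (ascPochhammer ℝ n).eval (y + 1) := by
        simp [ascPochhammer_succ_left]
      have hp := ascPochhammer_pos n (y + 1) (by linarith)
      have h2 : (ascPochhammer ℝ (n + 2)).eval y =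
          y * ((ascPochhammer ℝ n).eval (y + 1) * (y + 1 + n)) := by
        rw [← ascPochhammer_succ_eval, ascPochhammer_succ_left]; simp
      rw [Function.iterate_succ_apply', fwdDiff, ih _ (by linarith), ih _ hy,
        ascPochhammer_succ_eval n (y + 1), h1, h2]
      push_cast [Nat.factorial_succ]
      have : y + 1 + n ≠ 0 := by positivity
      field_simp
      ring
  rw [← key x hx, fwdDiff_iter_eq_sum_shift]
  refine Finset.sum_congr rfl fun k _ => ?_
  simp [div_eq_mul_inv]

theorem intervalIntegral_beta {u v : ℝ} (hu : 0 < u) (hv : 0 < v) :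
    IntervalIntegrable (fun t : ℝ => t ^ (u - 1) * (1 - t) ^ (v - 1)) volume 0 1 ∧
      ∫ t in (0 : ℝ)..1, t ^ (u - 1) * (1 - t) ^ (v - 1) = ProbabilityTheory.beta u v := by
  have hc := Complex.betaIntegral_convergent (u := u) (v := v) (by simpa) (by simpa)
  have heq : ∀ t ∈ Set.Ioc (0 : ℝ) 1, (t : ℂ) ^ ((u : ℂ) - 1) * (1 - (t : ℂ)) ^ ((v : ℂ) - 1) =
      ((t ^ (u - 1) * (1 - t) ^ (v - 1) : ℝ) : ℂ) := by
    intro t ht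
    rw [Complex.ofReal_mul, Complex.ofReal_cpow ht.1.le, Complex.ofReal_cpow (by linarith [ht.2])]
    push_cast
    rfl
  constructor
  · rw [intervalIntegrable_iff_integrableOn_Ioc_of_le zero_le_one] at hc ⊢
    have := hc.congr_fun heq measurableSet_Ioc
    simpa [IntegrableOn] using this.re
  · rw [ProbabilityTheory.beta_eq_betaIntegralReal u v hu hv, Complex.betaIntegral,
      intervalIntegral.integral_of_le zero_le_one, intervalIntegral.integral_of_le zero_le_one,
      setIntegral_congr_fun measurableSet_Ioc heq, integral_complex_ofReal, Complex.ofReal_re]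

theorem intervalIntegral_rpow_mul_one_sub_pow_rpow {r : ℕ} (hr : r ≠ 0) {s a : ℝ} (hs : -1 < s)
    (ha : -1 < a) :
    IntervalIntegrable (fun t : ℝ => t ^ s * (1 - t ^ r) ^ a) volume 0 1 ∧
      ∫ t in (0 : ℝ)..1, t ^ s * (1 - t ^ r) ^ a =
        ProbabilityTheory.beta ((s + 1) / r) (a + 1) / r := by
  have hr0 : (0 : ℝ) < r := by positivity
  obtain ⟨hi, hv⟩ := intervalIntegral_beta (u := (s + 1) / r) (v := a + 1)
    (div_pos (by linarith) hr0) (by linarith)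
  set f : ℝ → ℝ := (Set.Ioc 0 1).indicator
    fun t => t ^ ((s + 1) / r - 1) * (1 - t) ^ (a + 1 - 1) with hf
  have hcomp : Set.EqOn (fun x : ℝ => ((r : ℝ) * x ^ ((r : ℝ) - 1)) • f (x ^ (r : ℝ)))
      ((Set.Ioc 0 1).indicator fun t => r * (t ^ s * (1 - t ^ r) ^ a)) (Set.Ioi 0) := by
    intro x hx
    have hx : 0 < x := hx
    by_cases h1 : x ≤ 1
    · have hm : x ^ (r : ℝ) ∈ Set.Ioc (0 : ℝ) 1 :=
        ⟨by positivity, Real.rpow_le_one hx.le h1 hr0.le⟩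
      have hm' : x ∈ Set.Ioc (0 : ℝ) 1 := ⟨hx, h1⟩
      simp only [hf, Set.indicator_of_mem hm, Set.indicator_of_mem hm', smul_eq_mul]
      rw [← Real.rpow_mul hx.le, mul_assoc, ← mul_assoc (x ^ _), ← Real.rpow_add hx,
        Real.rpow_natCast]
      congr 4
      · field_simp; ring
      · ring
    · have hm : x ^ (r : ℝ) ∉ Set.Ioc (0 : ℝ) 1 := fun h =>
        (Real.one_lt_rpow (not_le.1 h1) hr0).not_ge h.2
      have hm' : x ∉ Set.Ioc (0 : ℝ) 1 := fun h => h1 h.2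
      simp only [hf, Set.indicator_of_notMem hm, Set.indicator_of_notMem hm', smul_zero]
  have hsub : Set.Ioi (0 : ℝ) ∩ Set.Ioc 0 1 = Set.Ioc 0 1 :=
    Set.inter_eq_right.2 fun x hx => hx.1
  have hII := integrableOn_Ioi_comp_rpow_iff f hr0.ne'
  have hcov := integral_comp_rpow_Ioi_of_pos (g := f) hr0
  rw [abs_of_pos hr0, integrableOn_congr_fun hcomp measurableSet_Ioi, hf,
    IntegrableOn, IntegrableOn,
    integrable_indicator_iff measurableSet_Ioc, integrable_indicator_iff measurableSet_Ioc,
    IntegrableOn, IntegrableOn, Measure.restrict_restrict measurableSet_Ioc,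
    Set.inter_comm, hsub] at hII
  rw [setIntegral_congr_fun measurableSet_Ioi hcomp, hf, setIntegral_indicator measurableSet_Ioc,
    setIntegral_indicator measurableSet_Ioc, hsub] at hcov
  rw [intervalIntegrable_iff_integrableOn_Ioc_of_le zero_le_one] at hi ⊢
  rw [intervalIntegral.integral_of_le zero_le_one] at hv ⊢
  constructor
  · have := (hII.2 hi).const_mul (r : ℝ)⁻¹
    refine this.congr (Filter.Eventually.of_forall fun t => ?_)
    simp only
    field_simp
  · rw [hv, integral_const_mul] at hcov
    rw [← hcov]; field_simp

theorem ProbabilityTheory.beta_add_sq_lt {x c d : ℝ} (hx : 0 < x) (hc : 0 < c) (hd : 0 < d) :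
    ProbabilityTheory.beta (x + d) c ^ 2 <
      ProbabilityTheory.beta x c * ProbabilityTheory.beta (x + 2 * d) c := by
  obtain ⟨hi0, hv0⟩ := intervalIntegral_beta hx hc
  obtain ⟨hi1, hv1⟩ := intervalIntegral_beta (u := x + d) (by linarith) hc
  obtain ⟨hi2, hv2⟩ := intervalIntegral_beta (u := x + 2 * d) (by linarith) hc
  have hB := ProbabilityTheory.beta_pos hx hc
  have hB1 := ProbabilityTheory.beta_pos (show 0 < x + d by linarith) hc
  set B := ProbabilityTheory.beta x c
  set B₁ := ProbabilityTheory.beta (x + d) c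
  set B₂ := ProbabilityTheory.beta (x + 2 * d) c
  set l := B₁ / B with hl
  have hl0 : 0 < l := div_pos hB1 hB
  let F : ℝ → ℝ := fun t => l ^ 2 * (t ^ (x - 1) * (1 - t) ^ (c - 1)) -
    2 * l * (t ^ (x + d - 1) * (1 - t) ^ (c - 1)) + t ^ (x + 2 * d - 1) * (1 - t) ^ (c - 1)
  have hFi : IntervalIntegrable F volume 0 1 :=
    ((hi0.const_mul (l ^ 2)).sub (hi1.const_mul (2 * l))).add hi2
  have hF : ∀ t, 0 < t → F t = t ^ (x - 1) * (1 - t) ^ (c - 1) * (l - t ^ d) ^ 2 := by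
    intro t ht
    have h1 : t ^ (x + d - 1) = t ^ (x - 1) * t ^ d := by
      rw [← Real.rpow_add ht]; ring_nf
    have h2 : t ^ (x + 2 * d - 1) = t ^ (x - 1) * (t ^ d * t ^ d) := by
      rw [← Real.rpow_add ht, ← Real.rpow_add ht]; ring_nf
    simp only [F, h1, h2]
    ring
  have hFv : ∫ t in (0 : ℝ)..1, F t = l ^ 2 * B - 2 * l * B₁ + B₂ := by
    rw [intervalIntegral.integral_add ((hi0.const_mul (l ^ 2)).sub (hi1.const_mul (2 * l))) hi2,
      intervalIntegral.integral_sub (hi0.const_mul (l ^ 2)) (hi1.const_mul (2 * l)),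
      intervalIntegral.integral_const_mul, intervalIntegral.integral_const_mul, hv0, hv1, hv2]
  have hpos : 0 < ∫ t in (0 : ℝ)..1, F t := by
    rw [intervalIntegral.integral_pos_iff_support_of_nonneg_ae' _ hFi]
    · refine ⟨zero_lt_one, ?_⟩
      have hm : 0 < min 1 (l ^ d⁻¹) := by positivity
      refine lt_of_lt_of_le ?_ (measure_mono (s := Set.Ioo 0 (min 1 (l ^ d⁻¹))) ?_)
      · simpa using hm
      · rintro t ⟨ht0, ht⟩
        have ht1 := ht.trans_le (min_le_left _ _)
        have ht2 : t ^ d < l := by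
          have := Real.rpow_lt_rpow ht0.le (ht.trans_le (min_le_right _ _)) hd
          rwa [← Real.rpow_mul hl0.le, inv_mul_cancel₀ hd.ne', Real.rpow_one] at this
        refine ⟨?_, ht0, ht1.le⟩
        have h1 : 0 < 1 - t := by linarith
        have h2 : 0 < l - t ^ d := by linarith
        rw [Function.mem_support, hF t ht0]
        positivity
    · rw [Set.uIoc_of_le zero_le_one]
      refine (ae_restrict_iff' measurableSet_Ioc).2 (Filter.Eventually.of_forall fun t ht => ?_)
      have h1 : 0 ≤ 1 - t := by linarith [ht.2]
      have h0 := ht.1.le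
      rw [hF t ht.1]
      simp only [Pi.zero_apply]
      positivity
  rw [hFv, hl] at hpos
  have := mul_pos hpos hB
  have h3 : ((B₁ / B) ^ 2 * B - 2 * (B₁ / B) * B₁ + B₂) * B = B * B₂ - B₁ ^ 2 := by
    field_simp; ring
  linarith

theorem sum_pow_mul_ne_zero_of_antitone {r : ℕ} (hr : 2 ≤ r) {z : ℂ} (hz : z ^ r = 1)
    (hz1 : z ≠ 1) {h : ℕ → ℝ} (hh : ∀ j, j + 1 < r → h (j + 1) < h j) :
    ∑ j ∈ Finset.range r, z ^ j * (h j : ℂ) ≠ 0 := by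
  intro hs
  obtain ⟨m, rfl⟩ : ∃ m, r = m + 2 := ⟨r - 2, by omega⟩
  have hnorm : ‖z‖ = 1 := Complex.norm_eq_one_of_pow_eq_one hz (by omega)
  have hre : ∀ j, (z ^ j).re ≤ 1 := fun j =>
    (Complex.re_le_norm _).trans (by simp [hnorm])
  have abel : ∀ M : ℕ, (1 - z) * ∑ j ∈ Finset.range (M + 1), z ^ j * (h j : ℂ) =
      h 0 - z ^ (M + 1) * h M - ∑ j ∈ Finset.range M, z ^ (j + 1) * ((h j - h (j + 1) : ℝ) : ℂ) := by
    intro M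
    induction M with
    | zero => simp; ring
    | succ M ih =>
      rw [Finset.sum_range_succ, mul_add, ih, Finset.sum_range_succ _ M]
      push_cast
      ring
  have htel : ∑ j ∈ Finset.range (m + 1), (h j - h (j + 1)) = h 0 - h (m + 1) :=
    Finset.sum_range_sub' h (m + 1)
  have h1 := abel (m + 1)
  rw [hs, hz, mul_zero] at h1
  have h2 := congrArg Complex.re h1
  simp only [Complex.zero_re, one_mul, Complex.sub_re, Complex.ofReal_re, Complex.re_sum,
    Complex.re_mul_ofReal] at h2
  have h3 : ∑ j ∈ Finset.range (m + 1), (1 - (z ^ (j + 1)).re) * (h j - h (j + 1)) = 0 := by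
    simp only [sub_mul, one_mul, Finset.sum_sub_distrib (fun j => h j - h (j + 1))]
    rw [htel]
    linarith
  have h4 := (Finset.sum_eq_zero_iff_of_nonneg fun j hj => mul_nonneg
    (sub_nonneg.2 (hre (j + 1))) (sub_nonneg.2
      (hh j (by have := Finset.mem_range.1 hj; omega)).le)).1 h3 0 (by simp)
  have h5 := hh 0 (by omega)
  have h6 : z.re = 1 := by
    rcases mul_eq_zero.1 h4 with h | h
    · simp at h; linarith
    · exact absurd h (by simp at h5; simp; linarith)
  apply hz1
  have h7 : z.im = 0 := by
    have := Complex.sq_norm z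
    rw [hnorm, Complex.normSq_apply, h6] at this
    nlinarith
  exact Complex.ext h6 h7

theorem IsPrimitiveRoot.sum_pow_pow {r : ℕ} {ω : ℂ} (hω : IsPrimitiveRoot ω r) (N : ℕ) :
    ∑ j ∈ Finset.range r, (ω ^ N) ^ j = if r ∣ N then (r : ℂ) else 0 := by
  split_ifs with h
  · simp [(hω.pow_eq_one_iff_dvd N).2 h]
  · have h1 : ω ^ N ≠ 1 := fun h' => h ((hω.pow_eq_one_iff_dvd N).1 h')
    rw [geom_sum_eq h1, ← pow_mul, mul_comm, pow_mul, hω.pow_eq_one]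
    simp

/-- The real coefficient of `z ^ k` in `jacAngC r n α b z`. -/
noncomputable def jacAngCoeff (r n : ℕ) (α b : ℝ) (k : ℕ) : ℝ :=
  n.choose k * (Real.Gamma (n + α + (b + k) / r + 1) /
    (Real.Gamma (n + α + 1) * Real.Gamma ((b + k) / r + 1))) * (-1) ^ (n - k)

theorem jacAngC_eq_sum (r n : ℕ) (α b : ℝ) (z : ℂ) :
    jacAngC r n α b z = ∑ k ∈ Finset.range (n + 1), (jacAngCoeff r n α b k : ℂ) * z ^ k := by
  simp only [jacAngC, jacAngCoeff]
  push_cast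
  rfl

theorem sum_jacAngCoeff_mul_beta_eq_zero {r n m : ℕ} (hr : r ≠ 0) {α b : ℝ} (hα : -1 < α)
    (hb : 0 < b + r) (hm : 1 ≤ m) (hmn : m ≤ n) :
    ∑ k ∈ Finset.range (n + 1), jacAngCoeff r n α b k *
      ProbabilityTheory.beta ((b + k) / r + m) (α + 1) = 0 := by
  obtain ⟨p, rfl⟩ : ∃ p, m = p + 1 := ⟨m - 1, by omega⟩
  obtain ⟨q, rfl⟩ : ∃ q, n = p + 1 + q := ⟨n - (p + 1), by omega⟩
  have hr0 : (0 : ℝ) < r := by positivity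
  let P : ℝ[X] := (ascPochhammer ℝ p).comp (X + C 1) *
    (ascPochhammer ℝ q).comp (X + C (p + 1 + α + 1))
  have hP : P.natDegree < p + 1 + q := by
    have h1 := natDegree_mul_le (p := (ascPochhammer ℝ p).comp (X + C 1))
      (q := (ascPochhammer ℝ q).comp (X + C (p + 1 + α + 1)))
    simp only [natDegree_comp, natDegree_X_add_C, ascPochhammer_natDegree] at h1
    simp only [P]
    omega
  rw [← mul_zero (Real.Gamma (α + 1) / Real.Gamma ((p + 1 + q : ℕ) + α + 1)),
    ← sum_neg_one_pow_mul_choose_mul_eval_eq_zero hP b r, Finset.mul_sum]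
  refine Finset.sum_congr rfl fun k _ => ?_
  have hy : -1 < (b + k) / r := by
    rw [lt_div_iff₀ hr0]
    have : (0 : ℝ) ≤ k := by positivity
    linarith
  set y := (b + k) / r with hyd
  have h1 := Real.Gamma_add_nat_eq_ascPochhammer (x := y + 1) (by linarith) p
  have h2pos : 0 < y + p + 1 + α + 1 := by
    have : (0 : ℝ) ≤ p := by positivity
    linarith
  have h2 := Real.Gamma_add_nat_eq_ascPochhammer h2pos q
  have g1 := (Real.Gamma_pos_of_pos (show 0 < y + 1 by linarith)).ne'
  have g2 := (Real.Gamma_pos_of_pos h2pos).ne'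
  simp only [jacAngCoeff, ProbabilityTheory.beta, P, eval_mul, eval_comp, eval_add, eval_X, eval_C]
  push_cast
  simp only [← hyd]
  clear_value y
  rw [show (p : ℝ) + 1 + q + α + y + 1 = y + p + 1 + α + 1 + q by ring, h2,
    show y + ((p : ℝ) + 1) = y + 1 + p by ring, h1,
    show y + 1 + p + (α + 1) = y + p + 1 + α + 1 by ring,
    show y + ((p : ℝ) + 1 + α + 1) = y + p + 1 + α + 1 by ring]
  field_simp

theorem sum_jacAngCoeff_mul_beta_succ {r n : ℕ} (hr : r ≠ 0) (hn : 1 ≤ n) {α b : ℝ} (hα : -1 < α)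
    (hb : 0 < b + r) :
    ∑ k ∈ Finset.range (n + 1), jacAngCoeff r n α b k *
      ProbabilityTheory.beta ((b + k) / r + (n + 1 : ℕ)) (α + 1) =
    r * n.factorial * Real.Gamma (r * n + r * α + (b + r)) /
      Real.Gamma (r * n + n + r * α + (b + r) + 1) := by
  have hr0 : (0 : ℝ) < r := by positivity
  have hn1 : (1 : ℝ) ≤ n := by exact_mod_cast hn
  let P : ℝ[X] := (ascPochhammer ℝ n).comp (X + C 1)
  let Q : ℝ[X] := P /ₘ (X - C (-(n + α + 1)))
  have hPQ : ∀ y, P.eval y = (y + (n + α + 1)) * Q.eval y + P.eval (-(n + α + 1)) := by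
    intro y
    have := congrArg (eval y) (modByMonic_add_div P (X - C (-((n : ℝ) + α + 1))))
    rw [modByMonic_X_sub_C_eq_C_eval] at this
    simp only [eval_add, eval_mul, eval_sub, eval_X, eval_C] at this
    rw [← this]
    ring
  have hQ : Q.natDegree < n := by
    rw [natDegree_divByMonic _ (monic_X_sub_C _)]
    simp only [P, natDegree_comp, natDegree_X_add_C, ascPochhammer_natDegree, natDegree_X_sub_C]
    omega
  have hR : P.eval (-(n + α + 1)) = (-1) ^ n * (ascPochhammer ℝ n).eval (α + 1) := by
    have := ascPochhammer_eval_neg_eq_descPochhammer (R := ℝ) (n + α) n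
    simp only [P, eval_comp, eval_add, eval_X, eval_C]
    rw [show -((n : ℝ) + α + 1) + 1 = -(n + α) by ring, this,
      descPochhammer_eval_eq_ascPochhammer]
    congr 2; ring
  set x := r * n + r * α + (b + r) with hx
  have hx0 : 0 < x := by nlinarith
  have hterm : ∀ k ∈ Finset.range (n + 1), jacAngCoeff r n α b k *
      ProbabilityTheory.beta ((b + k) / r + (n + 1 : ℕ)) (α + 1) =
      Real.Gamma (α + 1) / Real.Gamma (n + α + 1) *
        ((-1 : ℝ) ^ (n - k) * n.choose k * Q.eval ((b + k) / r)) +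
      Real.Gamma (α + 1) / Real.Gamma (n + α + 1) * P.eval (-(n + α + 1)) * r *
        ((-1 : ℝ) ^ (n - k) * n.choose k / (x + k)) := by
    intro k _
    have hxy : (b + k) / r + (n + α + 1) = (x + k) / r := by
      rw [hx]; field_simp; ring
    have hy : -1 < (b + k) / r := by
      rw [lt_div_iff₀ hr0]
      have : (0 : ℝ) ≤ k := by positivity
      linarith
    have hPy := hPQ ((b + k) / r)
    rw [hxy] at hPy
    set y := (b + k) / r with hyd
    have h1 := Real.Gamma_add_nat_eq_ascPochhammer (x := y + 1) (by linarith) n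
    have h2pos : 0 < n + α + y + 1 := by linarith
    have h2 := Real.Gamma_add_one h2pos.ne'
    have g1 := (Real.Gamma_pos_of_pos (show 0 < y + 1 by linarith)).ne'
    have g2 := (Real.Gamma_pos_of_pos h2pos).ne'
    have g3 := (Real.Gamma_pos_of_pos (show 0 < n + α + 1 by linarith)).ne'
    have h3 : (ascPochhammer ℝ n).eval (y + 1) = P.eval y := by simp [P]
    have hxk : x + k ≠ 0 := by positivity
    simp only [jacAngCoeff, ProbabilityTheory.beta]
    push_cast
    simp only [← hyd]
    clear_value y
    rw [show y + ((n : ℝ) + 1) = y + 1 + n by ring, h1,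
      show y + 1 + n + (α + 1) = n + α + y + 1 + 1 by ring, h2, h3, hPy,
      show (n : ℝ) + α + y + 1 = (x + k) / r by rw [← hxy]; ring]
    rw [show (n : ℝ) + α + y + 1 = (x + k) / r by rw [← hxy]; ring] at g2
    field_simp
  rw [Finset.sum_congr rfl hterm, Finset.sum_add_distrib, ← Finset.mul_sum, ← Finset.mul_sum,
    sum_neg_one_pow_mul_choose_mul_eval_eq_zero hQ, sum_neg_one_pow_mul_choose_div_add hx0, hR]
  have h1 := Real.Gamma_add_nat_eq_ascPochhammer (x := α + 1) (by linarith) n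
  have h2 := Real.Gamma_add_nat_eq_ascPochhammer hx0 (n + 1)
  have g1 := (Real.Gamma_pos_of_pos (show 0 < α + 1 by linarith)).ne'
  have g2 := (Real.Gamma_pos_of_pos hx0).ne'
  have p1 := (ascPochhammer_pos n (α + 1) (by linarith)).ne'
  have p2 := (ascPochhammer_pos (n + 1) x hx0).ne'
  rw [show (n : ℝ) + α + 1 = α + 1 + n by ring, h1,
    show (r : ℝ) * n + n + r * α + (b + r) + 1 = x + (n + 1 : ℕ) by rw [hx]; push_cast; ring, h2]
  field_simp
  rw [← pow_mul, mul_comm n 2, pow_mul]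
  simp

theorem sum_Icc_one_eq_sum_range {M : Type*} [AddCommMonoid M] (f : ℕ → M) (r : ℕ) :
    ∑ j ∈ Finset.Icc 1 r, f j = ∑ j ∈ Finset.range r, f (j + 1) := by
  rw [Finset.range_eq_Ico, Finset.sum_Ico_add' f 0 r 1]
  rfl

/-- Summing the moments over the arms of the `r`-star retains only one residue class. -/
theorem sum_star_integral_eq {r : ℕ} {ω : ℂ} (hω : IsPrimitiveRoot ω r) (hr : r ≠ 0)
    {w : ℝ → ℝ} (hw : ∀ q : ℕ, IntervalIntegrable (fun t : ℝ => t ^ q * w t) volume 0 1)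
    (c : ℂ) (u : ℕ → ℕ → ℂ) (n ℓ k : ℕ) :
    ∑ j ∈ Finset.Icc 1 r, ω ^ (j - 1) * ∫ t in (0 : ℝ)..1,
      (ω ^ (j - 1) * (t : ℂ)) ^ ℓ *
        ((c * ∑ i ∈ Finset.range r, ω ^ ((((j : ℤ) - k) % r).toNat * i) *
          ∑ q ∈ Finset.range (n + 1), u i q *
            (ω ^ (1 - (j : ℤ)) * (ω ^ (j - 1) * (t : ℂ))) ^ q) * ω ^ (1 - (k : ℤ))) *
        (w t : ℂ) =
    c * ∑ i ∈ Finset.range r, ω ^ ((1 - (k : ℤ)) * (1 + i)) *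
      (if r ∣ 1 + ℓ + i then (r : ℂ) else 0) *
      ∑ q ∈ Finset.range (n + 1), u i q * ((∫ t in (0 : ℝ)..1, t ^ (ℓ + q) * w t : ℝ) : ℂ) := by
  have hω0 : ω ≠ 0 := hω.ne_zero hr
  have hswap : ∀ v : ℕ → ℕ → ℂ, ∀ C : ℂ,
      ∫ t in (0 : ℝ)..1, ∑ i ∈ Finset.range r, ∑ q ∈ Finset.range (n + 1),
        C * v i q * ((t ^ (ℓ + q) * w t : ℝ) : ℂ) =
      ∑ i ∈ Finset.range r, ∑ q ∈ Finset.range (n + 1),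
        C * v i q * ((∫ t in (0 : ℝ)..1, t ^ (ℓ + q) * w t : ℝ) : ℂ) := by
    intro v C
    have hii : ∀ i q, IntervalIntegrable
        (fun t : ℝ => C * v i q * ((t ^ (ℓ + q) * w t : ℝ) : ℂ)) volume 0 1 := fun i q =>
      IntervalIntegrable.const_mul ⟨(hw (ℓ + q)).1.ofReal, (hw (ℓ + q)).2.ofReal⟩ _
    have hsum : ∀ i, IntervalIntegrable (fun t : ℝ => ∑ q ∈ Finset.range (n + 1),
        C * v i q * ((t ^ (ℓ + q) * w t : ℝ) : ℂ)) volume 0 1 := fun i => by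
      simpa only [Finset.sum_fn] using
        IntervalIntegrable.sum (Finset.range (n + 1)) fun q _ => hii i q
    rw [intervalIntegral.integral_finsetSum fun i _ => hsum i]
    refine Finset.sum_congr rfl fun i _ => ?_
    rw [intervalIntegral.integral_finsetSum fun q _ => hii i q]
    refine Finset.sum_congr rfl fun q _ => ?_
    rw [intervalIntegral.integral_const_mul, intervalIntegral.integral_ofReal]
  have hmod : ∀ j i : ℕ, ω ^ ((((j : ℤ) - k) % r).toNat * i) = ω ^ (((j : ℤ) - k) * i) := by
    intro j i
    have h0 : 0 ≤ ((j : ℤ) - k) % r := Int.emod_nonneg _ (by exact_mod_cast hr)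
    rw [← zpow_natCast]
    push_cast
    rw [Int.toNat_of_nonneg h0]
    nth_rewrite 2 [← Int.emod_add_mul_ediv ((j : ℤ) - k) r]
    rw [add_mul, zpow_add₀ hω0, mul_assoc (r : ℤ), zpow_mul ω (r : ℤ), zpow_natCast, hω.pow_eq_one,
      one_zpow, mul_one]
  have harm : ∀ j ∈ Finset.range r, ω ^ (j + 1 - 1) * ∫ t in (0 : ℝ)..1,
      (ω ^ (j + 1 - 1) * (t : ℂ)) ^ ℓ *
        ((c * ∑ i ∈ Finset.range r, ω ^ (((((j + 1 : ℕ) : ℤ) - k) % r).toNat * i) *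
          ∑ q ∈ Finset.range (n + 1), u i q *
            (ω ^ (1 - ((j + 1 : ℕ) : ℤ)) * (ω ^ (j + 1 - 1) * (t : ℂ))) ^ q) *
              ω ^ (1 - (k : ℤ))) * (w t : ℂ) =
      ∑ i ∈ Finset.range r, ∑ q ∈ Finset.range (n + 1),
        c * (ω ^ ((1 - (k : ℤ)) * (1 + i)) * (ω ^ (1 + ℓ + i)) ^ j * u i q) *
          ((∫ t in (0 : ℝ)..1, t ^ (ℓ + q) * w t : ℝ) : ℂ) := by
    intro j _
    rw [← hswap, ← intervalIntegral.integral_const_mul]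
    congr 1
    ext t
    have h1 : ω ^ (1 - ((j + 1 : ℕ) : ℤ)) * (ω ^ (j + 1 - 1) * (t : ℂ)) = t := by
      rw [← mul_assoc, Nat.add_sub_cancel, ← zpow_natCast, ← zpow_add₀ hω0]
      simp
    rw [h1, Nat.add_sub_cancel]
    simp only [Finset.mul_sum, Finset.sum_mul]
    refine Finset.sum_congr rfl fun i _ => Finset.sum_congr rfl fun q _ => ?_
    have h2 : ω ^ ((1 - (k : ℤ)) * (1 + i)) * (ω ^ (1 + ℓ + i)) ^ j =
        ω ^ j * (ω ^ j) ^ ℓ * ω ^ ((((j + 1 : ℕ) : ℤ) - k) * i) * ω ^ (1 - (k : ℤ)) := by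
      simp only [← zpow_natCast, ← zpow_mul, ← zpow_add₀ hω0]
      congr 1
      push_cast
      ring
    rw [h2, hmod, Complex.ofReal_mul, Complex.ofReal_pow, mul_pow, pow_add]
    ring
  rw [sum_Icc_one_eq_sum_range, Finset.sum_congr rfl harm, Finset.sum_comm, Finset.mul_sum]
  refine Finset.sum_congr rfl fun i _ => ?_
  rw [Finset.sum_comm, ← hω.sum_pow_pow, Finset.mul_sum, Finset.mul_sum]
  refine Finset.sum_congr rfl fun q _ => ?_
  simp only [Finset.mul_sum, Finset.sum_mul]
  refine Finset.sum_congr rfl fun j _ => ?_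
  ring

theorem jacAngCoeff_self (r n : ℕ) (α b : ℝ) : jacAngCoeff r n α b n =
    Real.Gamma (n + α + (b + n) / r + 1) /
      (Real.Gamma (n + α + 1) * Real.Gamma ((b + n) / r + 1)) := by
  simp [jacAngCoeff]

theorem jacAngCoeff_self_pos {r n : ℕ} (hr : r ≠ 0) (hn : 1 ≤ n) {α b : ℝ} (hα : -1 < α)
    (hb : 0 < b + r) : 0 < jacAngCoeff r n α b n := by
  have hr0 : (0 : ℝ) < r := by positivity
  have hn1 : (1 : ℝ) ≤ n := by exact_mod_cast hn
  have hy : -1 < (b + n) / r := by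
    rw [lt_div_iff₀ hr0]
    linarith
  rw [jacAngCoeff_self]
  exact div_pos (Real.Gamma_pos_of_pos (by linarith))
    (mul_pos (Real.Gamma_pos_of_pos (by linarith)) (Real.Gamma_pos_of_pos (by linarith)))

theorem jacAngCoeff_pred_div_self {r n : ℕ} (hr : r ≠ 0) (hn : 1 ≤ n) {α b : ℝ} (hα : -1 < α)
    (hb : 0 < b + r) :
    jacAngCoeff r n α b (n - 1) / jacAngCoeff r n α b n =
      -n * (ProbabilityTheory.beta ((b + n) / r + 1) (n + α) /
        ProbabilityTheory.beta ((b - 1 + n) / r + 1) (n + α)) := by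
  have hr0 : (0 : ℝ) < r := by positivity
  have hn1 : (1 : ℝ) ≤ n := by exact_mod_cast hn
  have hy : -1 < (b + n) / r := by
    rw [lt_div_iff₀ hr0]
    linarith
  have hy' : -1 < (b - 1 + n) / r := by
    rw [lt_div_iff₀ hr0]
    linarith
  have hch : n.choose (n - 1) = n := by
    obtain ⟨m, rfl⟩ : ∃ m, n = m + 1 := ⟨n - 1, by omega⟩
    simp
  have hpow : n - (n - 1) = 1 := by omega
  rw [jacAngCoeff_self, jacAngCoeff, hch, hpow]
  have hcast : b + ((n - 1 : ℕ) : ℝ) = b - 1 + n := by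
    push_cast [hn]; ring
  rw [hcast]
  simp only [ProbabilityTheory.beta]
  generalize (b + n) / r = y at *
  generalize (b - 1 + n) / r = y' at *
  rw [show y + 1 + (n + α) = n + α + y + 1 by ring, show y' + 1 + (n + α) = n + α + y' + 1 by ring]
  have g1 := (Real.Gamma_pos_of_pos (show 0 < y + 1 by linarith)).ne'
  have g2 := (Real.Gamma_pos_of_pos (show 0 < y' + 1 by linarith)).ne'
  have g3 := (Real.Gamma_pos_of_pos (show 0 < n + α + y + 1 by linarith)).ne'
  have g4 := (Real.Gamma_pos_of_pos (show 0 < n + α + y' + 1 by linarith)).ne'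
  have g5 := (Real.Gamma_pos_of_pos (show 0 < n + α + 1 by linarith)).ne'
  have g6 := (Real.Gamma_pos_of_pos (show 0 < n + α by linarith)).ne'
  field_simp

theorem sum_pow_mul_jacAngCoeff_pred_ne_zero {r n : ℕ} (hr : 2 ≤ r) (hn : 1 ≤ n) {α β : ℝ}
    (hα : -1 < α) (hβ : -1 < β) {z : ℂ} (hz : z ^ r = 1) (hz1 : z ≠ 1) :
    ∑ j ∈ Finset.range r, z ^ j *
      ((jacAngCoeff r n α (β - j) (n - 1) / jacAngCoeff r n α (β - j) n : ℝ) : ℂ) ≠ 0 := by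
  have hr0 : (0 : ℝ) < r := by positivity
  have hn1 : (1 : ℝ) ≤ n := by exact_mod_cast hn
  have key := sum_pow_mul_ne_zero_of_antitone hr hz hz1
    (h := fun j => ProbabilityTheory.beta ((β - j + n) / r + 1) (n + α) /
        ProbabilityTheory.beta ((β - j - 1 + n) / r + 1) (n + α)) ?_
  · have heq : ∀ j ∈ Finset.range r, z ^ j *
        ((jacAngCoeff r n α (β - j) (n - 1) / jacAngCoeff r n α (β - j) n : ℝ) : ℂ) =
        -n * (z ^ j * ((ProbabilityTheory.beta ((β - j + n) / r + 1) (n + α) /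
        ProbabilityTheory.beta ((β - j - 1 + n) / r + 1) (n + α) : ℝ) : ℂ)) := by
      intro j hj
      have hj : (j : ℝ) + 1 ≤ r := by exact_mod_cast Finset.mem_range.1 hj
      rw [jacAngCoeff_pred_div_self (by omega) hn hα (by linarith)]
      push_cast
      ring
    rw [Finset.sum_congr rfl heq, ← Finset.mul_sum]
    exact mul_ne_zero (by simp; omega) key
  · intro j hj
    have hj : (j : ℝ) + 1 + 1 ≤ r := by exact_mod_cast hj
    push_cast
    have hx : 0 < (β - (j + 1) - 1 + n) / r + 1 := by
      have : -1 < (β - (j + 1) - 1 + n) / r := by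
        rw [lt_div_iff₀ hr0]; linarith
      linarith
    have hc : 0 < n + α := by linarith
    have hd : (0 : ℝ) < 1 / r := by positivity
    have h := ProbabilityTheory.beta_add_sq_lt hx hc hd
    have e1 : (β - (j + 1) - 1 + n) / r + 1 + 1 / r = (β - (j + 1) + n) / r + 1 := by ring
    have e2 : (β - (j + 1) - 1 + n) / r + 1 + 2 * (1 / r) = (β - j + n) / r + 1 := by ring
    have e3 : (β - j - 1 + n) / r + 1 = (β - (j + 1) + n) / r + 1 := by ring
    have p1 := ProbabilityTheory.beta_pos hx hc
    have p2 := ProbabilityTheory.beta_pos (show 0 < (β - (j + 1) - 1 + n) / r + 1 + 1 / r by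
      positivity) hc
    rw [e1] at p2
    rw [e1, e2] at h
    rw [e3, div_lt_div_iff₀ p1 p2]
    linarith

theorem integral_pow_mul_weight {r : ℕ} (hr : r ≠ 0) {α β : ℝ} (hα : -1 < α) (hβ : -1 < β)
    (q : ℕ) :
    IntervalIntegrable (fun t : ℝ => t ^ q * (t ^ β * (1 - t ^ r) ^ α)) volume 0 1 ∧
      ∫ t in (0 : ℝ)..1, t ^ q * (t ^ β * (1 - t ^ r) ^ α) =
        ProbabilityTheory.beta ((q + β + 1) / r) (α + 1) / r := by
  have hq : (0 : ℝ) ≤ q := by positivity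
  obtain ⟨h1, h2⟩ := intervalIntegral_rpow_mul_one_sub_pow_rpow hr (s := q + β) (a := α)
    (by linarith) hα
  have heq : Set.EqOn (fun t : ℝ => t ^ ((q : ℝ) + β) * (1 - t ^ r) ^ α)
      (fun t : ℝ => t ^ q * (t ^ β * (1 - t ^ r) ^ α)) (Set.Ioc 0 1) := by
    intro t ht
    simp only [Real.rpow_add ht.1, Real.rpow_natCast, mul_assoc]
  rw [intervalIntegrable_iff_integrableOn_Ioc_of_le zero_le_one] at h1 ⊢
  rw [intervalIntegral.integral_of_le zero_le_one] at h2 ⊢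
  rw [← setIntegral_congr_fun measurableSet_Ioc heq]
  exact ⟨h1.congr_fun heq measurableSet_Ioc, h2⟩

theorem exists_polynomial_degree_eq_of_coeff {F : ℂ → ℂ} {n d : ℕ} {a : ℕ → ℂ} (hdn : d ≤ n)
    (hF : ∀ z, F z = ∑ q ∈ Finset.range (n + 1), a q * z ^ q)
    (hz : ∀ q, d < q → q ≤ n → a q = 0) (had : a d ≠ 0) :
    ∃ P : ℂ[X], (∀ z, P.eval z = F z) ∧ P.degree = (d : WithBot ℕ) := by
  have hcoeff : ∀ i, (∑ q ∈ Finset.range (n + 1), monomial q (a q)).coeff i =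
      if i ≤ n then a i else 0 := by
    intro i
    simp [finsetSum_coeff, coeff_monomial]
  refine ⟨∑ q ∈ Finset.range (n + 1), monomial q (a q), fun z => ?_, ?_⟩
  · rw [hF, eval_finsetSum]
    simp [eval_monomial]
  · refine degree_eq_of_le_of_coeff_ne_zero ?_ ?_
    · refine (degree_le_iff_coeff_zero _ _).2 fun i hi => ?_
      rw [hcoeff]
      have hi : d < i := by exact_mod_cast hi
      split_ifs with h
      · exact hz i hi h
      · rfl
    · rw [hcoeff, if_pos hdn]
      exact had

end

/-- the type I Jacobi-Angelesco vector above the diagonal, for the multi-index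
(n,…,n) + e_k: degree conditions, orthogonality and normalization on the r-star. -/
theorem jacobiAngelesco_above_diag_typeI_rstar
    (r : ℕ) (hr : 2 ≤ r) (α β : ℝ) (hα : -1 < α) (hβ : -1 < β) (n : ℕ) (hn : 1 ≤ n) :
    let ω : ℂ := Complex.exp (2 * Real.pi * Complex.I / r)
    let ν : ℝ → ℝ := fun b => Real.Gamma (n + α + (b + n) / r + 1) /
      (Real.Gamma (n + α + 1) * Real.Gamma ((b + n) / r + 1))
    let τ : ℝ := r * n.factorial * Real.Gamma (n + α + 1) * Real.Gamma ((β + n + 1) / r) *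
      Real.Gamma ((r : ℝ) * n + r * α + β + 1) /
      (Real.Gamma (n + α + (β + n + 1) / r) * Real.Gamma ((r : ℝ) * n + n + r * α + β + 2))
    let Aell : ℕ → ℂ → ℂ := fun ℓ z =>
      (1 / (τ : ℂ)) * ∑ j ∈ Finset.range r,
        (ω ^ (ℓ * j) / ((ν (β - j) : ℝ) : ℂ)) * jacAngC r n α (β - j) z
    let A : ℕ → ℕ → ℂ → ℂ := fun k j z =>
      Aell ((((j : ℤ) - k) % r).toNat) (ω ^ (1 - (j : ℤ)) * z) * ω ^ (1 - (k : ℤ))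
    ∀ k, 1 ≤ k → k ≤ r →
      ((∀ j, 1 ≤ j → j ≤ r → ∃ P : Polynomial ℂ,
          (∀ z, P.eval z = A k j z) ∧
          P.degree = ((if j = k then n else n - 1 : ℕ) : WithBot ℕ)) ∧
        (∀ ℓ : ℕ, (ℓ : ℤ) ≤ (r : ℤ) * n - 1 →
          ∑ j ∈ Finset.Icc 1 r, ω ^ (j - 1) * ∫ t in (0:ℝ)..1,
            (ω ^ (j - 1) * (t : ℂ)) ^ ℓ * A k j (ω ^ (j - 1) * (t : ℂ)) *
              ((t ^ β * (1 - t ^ r) ^ α : ℝ) : ℂ) = 0) ∧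
        (∑ j ∈ Finset.Icc 1 r, ω ^ (j - 1) * ∫ t in (0:ℝ)..1,
            (ω ^ (j - 1) * (t : ℂ)) ^ (r * n) * A k j (ω ^ (j - 1) * (t : ℂ)) *
              ((t ^ β * (1 - t ^ r) ^ α : ℝ) : ℂ) = 1)) := by
  intro ω ν τ Aell A k hk1 hkr
  have hr0 : r ≠ 0 := by omega
  have hrpos : (0 : ℝ) < r := by positivity
  have hrC : (r : ℂ) ≠ 0 := by exact_mod_cast hr0
  have hn1 : (1 : ℝ) ≤ n := by exact_mod_cast hn
  have hω : IsPrimitiveRoot ω r := Complex.isPrimitiveRoot_exp r hr0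
  have hω0 : ω ≠ 0 := hω.ne_zero hr0
  have hb : ∀ i ∈ Finset.range r, 0 < β - (i : ℕ) + r := by
    intro i hi
    have : (i : ℝ) + 1 ≤ r := by exact_mod_cast Finset.mem_range.1 hi
    linarith
  have hν : ∀ b, ν b = jacAngCoeff r n α b n := fun b => (jacAngCoeff_self r n α b).symm
  have hνpos : ∀ i ∈ Finset.range r, 0 < jacAngCoeff r n α (β - (i : ℕ)) n := fun i hi =>
    jacAngCoeff_self_pos hr0 hn hα (hb i hi)
  have hra : 0 < (r : ℝ) * n + r * α := by nlinarith
  have hyn : 0 < (β + n + 1) / r := div_pos (by linarith) hrpos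
  have G1 := Real.Gamma_pos_of_pos (show 0 < n + α + 1 by linarith)
  have G2 := Real.Gamma_pos_of_pos hyn
  have G3 := Real.Gamma_pos_of_pos (show 0 < (r : ℝ) * n + r * α + β + 1 by linarith)
  have G4 := Real.Gamma_pos_of_pos (show 0 < n + α + (β + n + 1) / r by linarith)
  have G5 := Real.Gamma_pos_of_pos (show 0 < (r : ℝ) * n + n + r * α + β + 2 by linarith)
  have hτ : 0 < τ := by positivity
  have hτC : (τ : ℂ) ≠ 0 := by exact_mod_cast hτ.ne'
  let u : ℕ → ℕ → ℝ := fun i q => jacAngCoeff r n α (β - i) q / jacAngCoeff r n α (β - i) n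
  have hA : ∀ j z, A k j z = ((1 / (τ : ℂ)) * ∑ i ∈ Finset.range r,
      ω ^ ((((j : ℤ) - k) % r).toNat * i) * ∑ q ∈ Finset.range (n + 1), (u i q : ℂ) *
        (ω ^ (1 - (j : ℤ)) * z) ^ q) * ω ^ (1 - (k : ℤ)) := by
    intro j z
    simp only [A, Aell, hν, jacAngC_eq_sum, u]
    congr 2
    refine Finset.sum_congr rfl fun i _ => ?_
    rw [Finset.mul_sum, Finset.mul_sum]
    refine Finset.sum_congr rfl fun q _ => ?_
    push_cast
    ring
  refine ⟨fun j hj1 hjr => ?_, fun ℓ hℓ => ?_, ?_⟩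
  · set m := (((j : ℤ) - k) % r).toNat with hm
    have h0 : 0 ≤ ((j : ℤ) - k) % r := Int.emod_nonneg _ (by exact_mod_cast hr0)
    have hmr : m < r := by
      have := Int.emod_lt_of_pos ((j : ℤ) - k) (show (0 : ℤ) < r by omega)
      omega
    have hm0 : m = 0 ↔ j = k := by
      constructor
      · intro h
        have h1 : ((j : ℤ) - k) % r = 0 := by omega
        obtain ⟨s, hs⟩ := Int.dvd_of_emod_eq_zero h1
        have h2 : s < 1 := by by_contra! h; nlinarith
        have h3 : -1 < s := by by_contra! h; nlinarith
        have h4 : s = 0 := by omega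
        rw [h4] at hs
        omega
      · rintro rfl
        simp [hm]
    have hzr : (ω ^ m) ^ r = 1 := by rw [← pow_mul, mul_comm, pow_mul, hω.pow_eq_one, one_pow]
    let a : ℕ → ℂ := fun q => (1 / (τ : ℂ)) * ω ^ (1 - (k : ℤ)) * (ω ^ (1 - (j : ℤ))) ^ q *
      ∑ i ∈ Finset.range r, (ω ^ m) ^ i * (u i q : ℂ)
    have hF : ∀ z, A k j z = ∑ q ∈ Finset.range (n + 1), a q * z ^ q := by
      intro z
      rw [hA]
      simp only [a, Finset.mul_sum, Finset.sum_mul]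
      rw [Finset.sum_comm]
      refine Finset.sum_congr rfl fun q _ => Finset.sum_congr rfl fun i _ => ?_
      rw [mul_pow, pow_mul]
      ring
    have hpre : ∀ q : ℕ, (1 / (τ : ℂ)) * ω ^ (1 - (k : ℤ)) * (ω ^ (1 - (j : ℤ))) ^ q ≠ 0 :=
      fun q => mul_ne_zero (mul_ne_zero (one_div_ne_zero hτC) (zpow_ne_zero _ hω0))
        (pow_ne_zero _ (zpow_ne_zero _ hω0))
    have htop : a n = (1 / (τ : ℂ)) * ω ^ (1 - (k : ℤ)) * (ω ^ (1 - (j : ℤ))) ^ n *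
        if r ∣ m then (r : ℂ) else 0 := by
      rw [← hω.sum_pow_pow]
      simp only [a]
      congr 1
      refine Finset.sum_congr rfl fun i hi => ?_
      simp [u, (hνpos i hi).ne']
    split_ifs with hjk
    · refine exists_polynomial_degree_eq_of_coeff le_rfl hF (fun q h1 h2 => by omega) ?_
      rw [htop, if_pos (by simp [hm0.2 hjk])]
      exact mul_ne_zero (hpre n) hrC
    · have hmne : m ≠ 0 := fun h => hjk (hm0.1 h)
      refine exists_polynomial_degree_eq_of_coeff (Nat.sub_le n 1) hF (fun q h1 h2 => ?_) ?_
      · obtain rfl : q = n := by omega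
        rw [htop, if_neg (Nat.not_dvd_of_pos_of_lt (by omega) hmr), mul_zero]
      · exact mul_ne_zero (hpre _) (sum_pow_mul_jacAngCoeff_pred_ne_zero hr hn hα hβ hzr
          (hω.pow_ne_one_of_pos_of_lt hmne hmr))
  all_goals
    simp only [hA]
    rw [sum_star_integral_eq hω hr0 (fun q => (integral_pow_mul_weight hr0 hα hβ q).1)]
    simp only [fun q => (integral_pow_mul_weight hr0 hα hβ q).2]
  · refine mul_eq_zero_of_right _ (Finset.sum_eq_zero fun i hi => ?_)
    split_ifs with hdvd
    · obtain ⟨m, hm⟩ := hdvd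
      have hir := Finset.mem_range.1 hi
      have hm1 : 1 ≤ m := by
        by_contra! h
        obtain rfl : m = 0 := by omega
        omega
      have hmn : m ≤ n := by
        by_contra! h
        have : r * (n + 1) ≤ r * m := Nat.mul_le_mul_left r h
        zify at this hm
        have hir : (i : ℤ) < r := by exact_mod_cast hir
        linarith
      have h := sum_jacAngCoeff_mul_beta_eq_zero hr0 hα (hb i hi) hm1 hmn
      refine mul_eq_zero_of_right _ ?_
      have hmR : (1 : ℝ) + ℓ + i = r * m := by exact_mod_cast hm
      have hsum : ∑ q ∈ Finset.range (n + 1), u i q *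
          (ProbabilityTheory.beta (((ℓ + q : ℕ) + β + 1) / r) (α + 1) / r) = 0 := by
        rw [← mul_zero (1 / (jacAngCoeff r n α (β - i) n * r)), ← h, Finset.mul_sum]
        refine Finset.sum_congr rfl fun q _ => ?_
        have : (((ℓ + q : ℕ) : ℝ) + β + 1) / r = (β - i + q) / r + m := by
          field_simp; push_cast; linarith
        rw [this]
        simp only [u]
        have := (hνpos i hi).ne'
        field_simp
      exact_mod_cast hsum
    · simp
  · have hlast : r - 1 ∈ Finset.range r := Finset.mem_range.2 (by omega)
    rw [Finset.sum_eq_single_of_mem (r - 1) hlast]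
    · have hcast : ((r - 1 : ℕ) : ℝ) = r - 1 := by push_cast [show 1 ≤ r by omega]; ring
      have hdvd : r ∣ 1 + r * n + (r - 1) := ⟨n + 1, by
        rw [mul_add]; omega⟩
      have hphase : ω ^ ((1 - (k : ℤ)) * (1 + ((r - 1 : ℕ) : ℤ))) = 1 := by
        rw [show 1 + ((r - 1 : ℕ) : ℤ) = r by omega, mul_comm, zpow_mul, zpow_natCast,
          hω.pow_eq_one, one_zpow]
      rw [if_pos hdvd, hphase]
      have h := sum_jacAngCoeff_mul_beta_succ hr0 hn hα (hb _ hlast)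
      have hsum : ∑ q ∈ Finset.range (n + 1), u (r - 1) q *
          (ProbabilityTheory.beta (((r * n + q : ℕ) + β + 1) / r) (α + 1) / r) = τ / r := by
        have hx : ∑ q ∈ Finset.range (n + 1), u (r - 1) q *
            (ProbabilityTheory.beta (((r * n + q : ℕ) + β + 1) / r) (α + 1) / r) =
            1 / (jacAngCoeff r n α (β - (r - 1 : ℕ)) n * r) *
              ∑ q ∈ Finset.range (n + 1), jacAngCoeff r n α (β - (r - 1 : ℕ)) q *
                ProbabilityTheory.beta ((β - (r - 1 : ℕ) + q) / r + (n + 1 : ℕ)) (α + 1) := by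
          rw [Finset.mul_sum]
          refine Finset.sum_congr rfl fun q _ => ?_
          have : (((r * n + q : ℕ) : ℝ) + β + 1) / r =
              (β - (r - 1 : ℕ) + q) / r + (n + 1 : ℕ) := by
            rw [hcast]; field_simp; push_cast; ring
          rw [this]
          simp only [u]
          have := (hνpos _ hlast).ne'
          field_simp
        rw [hx, h, jacAngCoeff_self, hcast]
        simp only [τ]
        rw [show n + α + (β - ((r : ℝ) - 1) + n) / r + 1 = n + α + (β + n + 1) / r by
            field_simp; ring,
          show (β - ((r : ℝ) - 1) + n) / r + 1 = (β + n + 1) / r by field_simp; ring,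
          show (r : ℝ) * n + r * α + (β - (r - 1) + r) = r * n + r * α + β + 1 by ring,
          show (r : ℝ) * n + n + r * α + (β - (r - 1) + r) + 1 = r * n + n + r * α + β + 2 by ring]
        generalize (β + n + 1) / (r : ℝ) = y at *
        field_simp
      have hsumC := congrArg (fun x : ℝ => (x : ℂ)) hsum
      push_cast at hsumC ⊢
      rw [hsumC]
      field_simp
    · intro i hi hne
      have hir := Finset.mem_range.1 hi
      rw [if_neg]
      · simp
      · intro hdvd
        have h1 : r ∣ 1 + i := by
          have : 1 + r * n + i = r * n + (1 + i) := by ring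
          rw [this] at hdvd
          exact (Nat.dvd_add_right (dvd_mul_right r n)).1 hdvd
        have := Nat.le_of_dvd (by omega) h1
        omega
end

section
/- Let α, β > −1 be real. For r ≥ 1 define a_{n,r}^{(α,β)} = [ n(n+α)(rn+rα+β) / ( r(rn+n+rα+β)(rn+n+rα+β+1) ) ] · [ Γ((β+n+1)/r) Γ(n+α+(β+n−1)/r) / ( Γ((β+n−1)/r+1) Γ(n+α+(β+n+1)/r) ) ], and for r > 1 define b_{n,r}^{(α,β)} = (n+α+(β−1)/r) Γ(n+α+(n+β−2)/r) Γ((n+β−1)/r+1) / [ (n+α+(n+β−1)/r) Γ(n+α+(n+β−1)/r) Γ((n+β−2)/r+1) ]. Then lim_{n→∞} a_{n,r}^{(α,β)} = r/(r+1)^{2+2/r} for every integer r ≥ 1, and lim_{n→∞} b_{n,r}^{(α,β)} = r/(r+1)^{1+1/r} for every integer r > 1. -/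
open Filter Topology in
/-- The functional equation of `Gamma` relates the shift by `s + 1` to the shift by `s`. -/
theorem tendsto_Gamma_add_div_add_one_iff (s : ℝ) :
    Tendsto (fun x : ℝ => Real.Gamma (x + (s + 1)) / (Real.Gamma x * x ^ (s + 1))) atTop (𝓝 1) ↔
      Tendsto (fun x : ℝ => Real.Gamma (x + s) / (Real.Gamma x * x ^ s)) atTop (𝓝 1) := by
  have h_quot : Tendsto (fun x : ℝ => (x + s) / x) atTop (𝓝 1) := by
    have h : Tendsto (fun x : ℝ => 1 + s / x) atTop (𝓝 (1 + 0)) :=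
      tendsto_const_nhds.add (tendsto_const_nhds.div_atTop tendsto_id)
    rw [add_zero] at h
    refine h.congr' ?_
    filter_upwards [eventually_gt_atTop 0] with x hx
    field_simp
  constructor
  · intro h
    have h' := h.div h_quot one_ne_zero
    rw [div_one] at h'
    refine h'.congr' ?_
    filter_upwards [eventually_gt_atTop 0, eventually_gt_atTop (-s)] with x hx hxs
    have hxs' : x + s ≠ 0 := by linarith
    have hΓ := (Real.Gamma_pos_of_pos hx).ne'
    have hpow := (Real.rpow_pos_of_pos hx s).ne'
    simp only [Pi.div_apply]
    rw [← add_assoc, Real.Gamma_add_one hxs', Real.rpow_add_one hx.ne']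
    field_simp
  · intro h
    have h' := h_quot.mul h
    rw [one_mul] at h'
    refine h'.congr' ?_
    filter_upwards [eventually_gt_atTop 0, eventually_gt_atTop (-s)] with x hx hxs
    have hxs' : x + s ≠ 0 := by linarith
    have hΓ := (Real.Gamma_pos_of_pos hx).ne'
    have hpow := (Real.rpow_pos_of_pos hx s).ne'
    rw [← add_assoc, Real.Gamma_add_one hxs', Real.rpow_add_one hx.ne']
    field_simp

/-- Upper half of Wendel's inequality. -/
theorem Gamma_add_le_mul_rpow {x s : ℝ} (hx : 0 < x) (hs : 0 < s) (hs1 : s < 1) :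
    Real.Gamma (x + s) ≤ Real.Gamma x * x ^ s := by
  have hΓ := Real.Gamma_pos_of_pos hx
  have h := Real.Gamma_mul_add_mul_le_rpow_Gamma_mul_rpow_Gamma hx (by linarith : 0 < x + 1)
    (by linarith : 0 < 1 - s) hs (by ring)
  rw [Real.Gamma_add_one hx.ne', Real.mul_rpow hx.le hΓ.le] at h
  calc Real.Gamma (x + s) = Real.Gamma ((1 - s) * x + s * (x + 1)) := by ring_nf
    _ ≤ Real.Gamma x ^ (1 - s) * (x ^ s * Real.Gamma x ^ s) := h
    _ = Real.Gamma x ^ (1 - s + s) * x ^ s := by rw [Real.rpow_add hΓ]; ring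
    _ = Real.Gamma x * x ^ s := by rw [sub_add_cancel, Real.rpow_one]

open Filter Topology in
/-- The asymptotics `Γ (x + s) ∼ Γ x * x ^ s` as `x → ∞`, for shifts in the unit interval. -/
theorem tendsto_Gamma_add_div_of_mem_Ioo {s : ℝ} (hs : 0 < s) (hs1 : s < 1) :
    Tendsto (fun x : ℝ => Real.Gamma (x + s) / (Real.Gamma x * x ^ s)) atTop (𝓝 1) := by
  have h_lower : Tendsto (fun x : ℝ => (1 + s / x) ^ (s - 1)) atTop (𝓝 1) := by
    have h : Tendsto (fun x : ℝ => 1 + s / x) atTop (𝓝 (1 + 0)) :=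
      tendsto_const_nhds.add (tendsto_const_nhds.div_atTop tendsto_id)
    rw [add_zero] at h
    simpa using h.rpow_const (p := s - 1) (Or.inl one_ne_zero)
  refine tendsto_of_tendsto_of_tendsto_of_le_of_le' h_lower tendsto_const_nhds ?_ ?_
  · filter_upwards [eventually_gt_atTop 0] with x hx
    have hΓ := Real.Gamma_pos_of_pos hx
    have hxs : 0 < x + s := by linarith
    have h := Gamma_add_le_mul_rpow hxs (by linarith : 0 < 1 - s) (by linarith)
    rw [show x + s + (1 - s) = x + 1 by ring, Real.Gamma_add_one hx.ne',
      show 1 - s = -(s - 1) by ring, Real.rpow_neg hxs.le, ← div_eq_mul_inv,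
      le_div_iff₀ (Real.rpow_pos_of_pos hxs _)] at h
    rw [le_div_iff₀ (mul_pos hΓ (Real.rpow_pos_of_pos hx s)),
      show 1 + s / x = (x + s) / x by field_simp, Real.div_rpow hxs.le hx.le]
    convert h using 1
    rw [Real.rpow_sub_one hx.ne' s]
    have hpow := (Real.rpow_pos_of_pos hx s).ne'
    field_simp
  · filter_upwards [eventually_gt_atTop 0] with x hx
    exact div_le_one_of_le₀ (Gamma_add_le_mul_rpow hx hs hs1)
      (mul_pos (Real.Gamma_pos_of_pos hx) (Real.rpow_pos_of_pos hx s)).le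

open Filter Topology in
/-- The asymptotics `Γ (x + s) ∼ Γ x * x ^ s` as `x → ∞`, for every real shift `s`. -/
theorem tendsto_Gamma_add_div (s : ℝ) :
    Tendsto (fun x : ℝ => Real.Gamma (x + s) / (Real.Gamma x * x ^ s)) atTop (𝓝 1) := by
  have h_fract : Tendsto (fun x : ℝ => Real.Gamma (x + Int.fract s) /
      (Real.Gamma x * x ^ Int.fract s)) atTop (𝓝 1) := by
    rcases (Int.fract_nonneg s).eq_or_lt with h | h
    · rw [← h]
      refine tendsto_const_nhds.congr' ?_
      filter_upwards [eventually_gt_atTop 0] with x hx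
      have hΓ := (Real.Gamma_pos_of_pos hx).ne'
      simp [hΓ]
    · exact tendsto_Gamma_add_div_of_mem_Ioo h (Int.fract_lt_one s)
  have h_int : ∀ m : ℤ, Tendsto (fun x : ℝ => Real.Gamma (x + (Int.fract s + m)) /
      (Real.Gamma x * x ^ (Int.fract s + m))) atTop (𝓝 1) := by
    intro m
    induction m using Int.induction_on with
    | zero => simpa using h_fract
    | succ k ih =>
      have h := (tendsto_Gamma_add_div_add_one_iff _).2 ih
      rw [add_assoc] at h
      exact_mod_cast h
    | pred k ih =>
      refine (tendsto_Gamma_add_div_add_one_iff _).1 ?_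
      rw [add_assoc]
      push_cast at ih ⊢
      rwa [sub_add_cancel]
  simpa only [Int.fract_add_floor] using h_int ⌊s⌋

open Filter Topology in
theorem tendsto_mul_natCast_add_div (c d : ℝ) :
    Tendsto (fun n : ℕ => (c * n + d) / n) atTop (𝓝 c) := by
  have h : Tendsto (fun n : ℕ => c + d / n) atTop (𝓝 (c + 0)) :=
    tendsto_const_nhds.add (tendsto_const_div_atTop_nhds_zero_nat d)
  rw [add_zero] at h
  refine h.congr' ?_
  filter_upwards [eventually_gt_atTop 0] with n hn
  have : (n : ℝ) ≠ 0 := by positivity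
  field_simp

open Filter Topology in
/-- The asymptotics of a ratio of Gamma values along an arithmetic progression. -/
theorem tendsto_Gamma_mul_natCast_add_div {c : ℝ} (hc : 0 < c) (d s : ℝ) :
    Tendsto (fun n : ℕ => Real.Gamma (c * n + d + s) / (Real.Gamma (c * n + d) * (n : ℝ) ^ s))
      atTop (𝓝 (c ^ s)) := by
  have hu : Tendsto (fun n : ℕ => c * n + d) atTop atTop :=
    tendsto_atTop_add_const_right _ d (tendsto_natCast_atTop_atTop.const_mul_atTop hc)
  have h := ((tendsto_Gamma_add_div s).comp hu).mul
    ((tendsto_mul_natCast_add_div c d).rpow_const (p := s) (Or.inl hc.ne'))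
  rw [one_mul] at h
  refine h.congr' ?_
  filter_upwards [eventually_gt_atTop 0, hu.eventually_gt_atTop 0] with n hn hun
  have hn' : (0 : ℝ) < n := by exact_mod_cast hn
  have hpow := (Real.rpow_pos_of_pos hun s).ne'
  simp only [Function.comp_apply]
  rw [Real.div_rpow hun.le hn'.le]
  field_simp

/-- The coefficients `a_{n,r}` converge to `r / (r + 1) ^ (2 + 2 / r)`. -/
theorem jacobiAngelesco_recurrence_coefficient_a_limit
    {r : ℕ} (hr : 1 ≤ r) (α β : ℝ) :
    Filter.Tendsto (fun n : ℕ =>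
        ((n : ℝ) * (n + α) * (r * n + r * α + β) /
            (r * (r * n + n + r * α + β) * (r * n + n + r * α + β + 1))) *
          (Real.Gamma ((β + n + 1) / r) * Real.Gamma (n + α + (β + n - 1) / r) /
            (Real.Gamma ((β + n - 1) / r + 1) * Real.Gamma (n + α + (β + n + 1) / r))))
      Filter.atTop (nhds ((r : ℝ) / ((r : ℝ) + 1) ^ ((2 : ℝ) + 2 / r))) := by
  have hr0 : (0 : ℝ) < r := by exact_mod_cast hr
  have hr1 : (0 : ℝ) < (r : ℝ) + 1 := by linarith
  have hc : (0 : ℝ) < 1 + 1 / r := by positivity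
  have hc' : (1 : ℝ) + 1 / r = (r + 1) / r := by field_simp
  have h_num := (tendsto_mul_natCast_add_div 1 α).mul
    (tendsto_mul_natCast_add_div r (r * α + β))
  have h_den := ((tendsto_mul_natCast_add_div (r + 1) (r * α + β)).mul
    (tendsto_mul_natCast_add_div (r + 1) (r * α + β + 1))).const_mul (r : ℝ)
  have h_rat := h_num.div h_den (by positivity)
  have h_lim := h_rat.mul
    ((tendsto_Gamma_mul_natCast_add_div (one_div_pos.2 hr0) ((β - 1) / r + 1) (2 / r - 1)).div
      (tendsto_Gamma_mul_natCast_add_div hc (α + (β - 1) / r) (2 / r))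
      (Real.rpow_pos_of_pos hc _).ne')
  have h_value : (1 : ℝ) * r / (r * ((r + 1) * (r + 1))) *
      ((1 / r) ^ ((2 : ℝ) / r - 1) / (1 + 1 / r) ^ ((2 : ℝ) / r)) =
      r / ((r : ℝ) + 1) ^ ((2 : ℝ) + 2 / r) := by
    rw [hc', Real.rpow_sub_one (by positivity), Real.div_rpow hr1.le hr0.le,
      Real.div_rpow zero_le_one hr0.le, Real.one_rpow, Real.rpow_add hr1, Real.rpow_two]
    have := (Real.rpow_pos_of_pos hr0 ((2 : ℝ) / r)).ne'
    have := (Real.rpow_pos_of_pos hr1 ((2 : ℝ) / r)).ne'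
    field_simp
  rw [h_value] at h_lim
  refine h_lim.congr' ?_
  filter_upwards [Filter.eventually_gt_atTop 0] with n hn
  have hn' : (0 : ℝ) < n := by exact_mod_cast hn
  have hpow := (Real.rpow_pos_of_pos hn' ((2 : ℝ) / r)).ne'
  simp only [Pi.div_apply]
  rw [Real.rpow_sub_one hn'.ne',
    show 1 / (r : ℝ) * n + ((β - 1) / r + 1) + (2 / r - 1) = (β + n + 1) / r by field_simp; ring,
    show 1 / (r : ℝ) * n + ((β - 1) / r + 1) = (β + n - 1) / r + 1 by field_simp; ring,
    show (1 + 1 / (r : ℝ)) * n + (α + (β - 1) / r) + 2 / r = n + α + (β + n + 1) / r by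
      field_simp; ring,
    show (1 + 1 / (r : ℝ)) * n + (α + (β - 1) / r) = n + α + (β + n - 1) / r by
      field_simp; ring,
    show ((r : ℝ) + 1) * n + (r * α + β) = r * n + n + r * α + β by ring,
    show ((r : ℝ) + 1) * n + (r * α + β + 1) = r * n + n + r * α + β + 1 by ring,
    show (r : ℝ) * n + (r * α + β) = r * n + r * α + β by ring, one_mul]
  generalize (r : ℝ) * n + n + r * α + β + 1 = A
  generalize (r : ℝ) * n + n + r * α + β = B
  generalize Real.Gamma _ = G₁
  generalize Real.Gamma _ = G₂
  generalize Real.Gamma _ = G₃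
  generalize Real.Gamma _ = G₄
  field_simp

/-- The coefficients `b_{n,r}` converge to `r / (r + 1) ^ (1 + 1 / r)`. -/
theorem jacobiAngelesco_recurrence_coefficient_b_limit
    {r : ℕ} (hr : 1 ≤ r) (α β : ℝ) :
    Filter.Tendsto (fun n : ℕ =>
        ((n + α + (β - 1) / r) * Real.Gamma ((n : ℝ) + α + ((n : ℝ) + β - 2) / r) *
            Real.Gamma (((n : ℝ) + β - 1) / r + 1)) /
          ((n + α + ((n : ℝ) + β - 1) / r) * Real.Gamma ((n : ℝ) + α + ((n : ℝ) + β - 1) / r) *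
            Real.Gamma (((n : ℝ) + β - 2) / r + 1)))
      Filter.atTop (nhds ((r : ℝ) / ((r : ℝ) + 1) ^ ((1 : ℝ) + 1 / r))) := by
  have hr0 : (0 : ℝ) < r := by exact_mod_cast hr
  have hr1 : (0 : ℝ) < (r : ℝ) + 1 := by linarith
  have hc : (0 : ℝ) < 1 + 1 / r := by positivity
  have hc' : (1 : ℝ) + 1 / r = (r + 1) / r := by field_simp
  have h_rat := (tendsto_mul_natCast_add_div 1 (α + (β - 1) / r)).div
    (tendsto_mul_natCast_add_div (1 + 1 / r) (α + (β - 1) / r)) hc.ne'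
  have h_lim := h_rat.mul
    ((tendsto_Gamma_mul_natCast_add_div (one_div_pos.2 hr0) ((β - 2) / r + 1) (1 / r)).div
      (tendsto_Gamma_mul_natCast_add_div hc (α + (β - 2) / r) (1 / r))
      (Real.rpow_pos_of_pos hc _).ne')
  have h_value : (1 : ℝ) / (1 + 1 / r) *
      ((1 / r) ^ ((1 : ℝ) / r) / (1 + 1 / r) ^ ((1 : ℝ) / r)) =
      r / ((r : ℝ) + 1) ^ ((1 : ℝ) + 1 / r) := by
    rw [Real.rpow_add hr1, Real.rpow_one, hc', Real.div_rpow hr1.le hr0.le,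
      Real.div_rpow zero_le_one hr0.le, Real.one_rpow]
    have := (Real.rpow_pos_of_pos hr0 ((1 : ℝ) / r)).ne'
    have := (Real.rpow_pos_of_pos hr1 ((1 : ℝ) / r)).ne'
    field_simp
  rw [h_value] at h_lim
  refine h_lim.congr' ?_
  filter_upwards [Filter.eventually_gt_atTop 0] with n hn
  have hn' : (0 : ℝ) < n := by exact_mod_cast hn
  have hpow := (Real.rpow_pos_of_pos hn' ((1 : ℝ) / r)).ne'
  simp only [Pi.div_apply]
  rw [show 1 / (r : ℝ) * n + ((β - 2) / r + 1) + 1 / r = (n + β - 1) / r + 1 by field_simp; ring,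
    show 1 / (r : ℝ) * n + ((β - 2) / r + 1) = (n + β - 2) / r + 1 by field_simp; ring,
    show (1 + 1 / (r : ℝ)) * n + (α + (β - 2) / r) + 1 / r = n + α + (n + β - 1) / r by
      field_simp; ring,
    show (1 + 1 / (r : ℝ)) * n + (α + (β - 2) / r) = n + α + (n + β - 2) / r by
      field_simp; ring,
    show (1 + 1 / (r : ℝ)) * n + (α + (β - 1) / r) = n + α + (n + β - 1) / r by
      field_simp; ring,
    show (1 : ℝ) * n + (α + (β - 1) / r) = n + α + (β - 1) / r by ring]
  generalize Real.Gamma _ = G₁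
  generalize Real.Gamma _ = G₂
  generalize Real.Gamma _ = G₃
  generalize Real.Gamma _ = G₄
  generalize (n : ℝ) + α + (n + β - 1) / r = A
  generalize (n : ℝ) + α + (β - 1) / r = B
  field_simp

/-- asymptotics of the nearest-neighbor recurrence coefficients of the type I
Jacobi-Angelesco polynomials on the r-star:
a_{n,r}^{(α,β)} → r/(r+1)^{2+2/r} (r ≥ 1) and b_{n,r}^{(α,β)} → r/(r+1)^{1+1/r} (r > 1). -/
theorem jacobiAngelesco_recurrence_coefficients_limit
    (r : ℕ) (hr : 1 ≤ r) (α β : ℝ) (hα : -1 < α) (hβ : -1 < β) :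
    Filter.Tendsto (fun n : ℕ =>
        ((n : ℝ) * (n + α) * (r * n + r * α + β) /
            (r * (r * n + n + r * α + β) * (r * n + n + r * α + β + 1))) *
          (Real.Gamma ((β + n + 1) / r) * Real.Gamma (n + α + (β + n - 1) / r) /
            (Real.Gamma ((β + n - 1) / r + 1) * Real.Gamma (n + α + (β + n + 1) / r))))
      Filter.atTop (nhds ((r : ℝ) / ((r : ℝ) + 1) ^ ((2 : ℝ) + 2 / r))) ∧
    (2 ≤ r → Filter.Tendsto (fun n : ℕ =>
        ((n + α + (β - 1) / r) * Real.Gamma ((n : ℝ) + α + ((n : ℝ) + β - 2) / r) *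
            Real.Gamma (((n : ℝ) + β - 1) / r + 1)) /
          ((n + α + ((n : ℝ) + β - 1) / r) * Real.Gamma ((n : ℝ) + α + ((n : ℝ) + β - 1) / r) *
            Real.Gamma (((n : ℝ) + β - 2) / r + 1)))
      Filter.atTop (nhds ((r : ℝ) / ((r : ℝ) + 1) ^ ((1 : ℝ) + 1 / r)))) := by
  exact ⟨jacobiAngelesco_recurrence_coefficient_a_limit hr α β,
    fun _ => jacobiAngelesco_recurrence_coefficient_b_limit hr α β⟩
end
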